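/- arXiv:1811.08733 — 2 statements merged into one kernel-verified Lean document; each statement's English description precedes it below -/
import Mathlib

section
/- Every nonzero polynomial tau-function of the DKP hierarchy in the even sector V_0, i.e. every nonzero τ ∈ ℂ[t_1,t_3,t_5,…] satisfying the BKP bilinear identity (the bosonic form of the DKP hierarchy on V_0), is of the form τ = a · Pf( ρ_{λ_i,λ_j}(t̃ + c_i, t̃ + c_j; b_i, b_j) )_{1≤i,j≤2n} for some n ≥ 0, some integers λ_1 > λ_2 > ⋯ > λ_{2n} ≥ 0, some sequences c_1,…,c_{2n} of complex numbers, some b_1,…,b_{2n} ∈ ℂ, and some nonzero a ∈ ℂ. -/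
/- ## Setup: the ring `B = ℂ[t₁,t₃,t₅,…]`, elementary Schur polynomials,
   vertex-operator coefficients, and the BKP bilinear identity. -/

noncomputable section

open MvPolynomial

/-- The polynomial ring `B = ℂ[t₁,t₃,t₅,…]`; variable `i` represents `t_{2i+1}`. -/
abbrev BRing : Type := MvPolynomial ℕ ℂ

/-- The universal elementary Schur polynomials `s_n`, defined by
`exp (∑_{j≥1} t_j z^j) = ∑_{n≥0} s_n(t) z^n`; here the variable `j` (for `j ≥ 1`)
represents `t_j`.  They satisfy `s_0 = 1` and `(n+1) s_{n+1} = ∑_{j=1}^{n+1} j t_j s_{n+1-j}`. -/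
def schurPoly : ℕ → MvPolynomial ℕ ℂ
  | 0 => 1
  | n + 1 =>
      ((n + 1 : ℂ))⁻¹ •
        ∑ j ∈ Finset.range (n + 1),
          ((j + 1 : ℂ)) • (MvPolynomial.X (j + 1) * schurPoly (n - j))
  termination_by n => n
  decreasing_by omega

/-- `s_n(c)` for a complex sequence `c = (c_1, c_2, …)` (the entry `c 0` is ignored). -/
def sC (n : ℕ) (c : ℕ → ℂ) : ℂ := MvPolynomial.eval c (schurPoly n)

/-- `s_n` evaluated on a sequence of elements of `B`. -/
def sB (n : ℕ) (c : ℕ → BRing) : BRing := MvPolynomial.aeval c (schurPoly n)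

/-- The sequence `t̃ = (t₁, 0, t₃, 0, t₅, 0, …)` of elements of `B`. -/
def tTilde : ℕ → BRing := fun j => if j % 2 = 1 then MvPolynomial.X ((j - 1) / 2) else 0

/-- The sequence `t̃ + c` for a constant sequence `c`. -/
def tShift (c : ℕ → ℂ) : ℕ → BRing := fun j => tTilde j + MvPolynomial.C (c j)

/-- `s̃_m = s_m(t̃) ∈ B` for `m ≥ 0`, and `0` for `m < 0`; these are the coefficients of
`exp (∑_{j>0 odd} t_j z^j)`. -/
def sTildeZ (m : ℤ) : BRing :=
  if 0 ≤ m then MvPolynomial.aeval tTilde (schurPoly m.toNat) else 0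

/-- `s_m(-t̃) ∈ B` for `m ≥ 0`, and `0` for `m < 0`; the coefficients of
`exp (-∑_{j>0 odd} t_j z^j)`. -/
def sTildeNegZ (m : ℤ) : BRing :=
  if 0 ≤ m then MvPolynomial.aeval (fun j => -(tTilde j)) (schurPoly m.toNat) else 0

/-- `p(t₁ - 2w, t₃ - (2/3)w³, t₅ - (2/5)w⁵, …)` as a polynomial in `w` (which stands for
`z⁻¹`) over `B`: this is `exp (-2∑_{j>0 odd} (1/j) ∂/∂t_j z^{-j}) p` by Taylor's formula. -/
def shiftMinus (p : BRing) : Polynomial BRing :=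
  MvPolynomial.aeval
    (fun i => Polynomial.C (MvPolynomial.X i) -
      Polynomial.C (MvPolynomial.C ((2 : ℂ) / ((2 * i + 1 : ℕ) : ℂ))) *
        Polynomial.X ^ (2 * i + 1)) p

/-- `p(t₁ + 2w, t₃ + (2/3)w³, …)`, i.e. `exp (2∑_{j>0 odd} (1/j) ∂/∂t_j z^{-j}) p`. -/
def shiftPlus (p : BRing) : Polynomial BRing :=
  MvPolynomial.aeval
    (fun i => Polynomial.C (MvPolynomial.X i) +
      Polynomial.C (MvPolynomial.C ((2 : ℂ) / ((2 * i + 1 : ℕ) : ℂ))) *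
        Polynomial.X ^ (2 * i + 1)) p

/-- The coefficient of `z^m` in
`exp (∑_{j>0 odd} t_j z^j) exp (-2∑_{j>0 odd} (1/j)(∂/∂t_j) z^{-j}) τ`. -/
def leftCoeff (τ : BRing) (m : ℤ) : BRing :=
  ∑ᶠ k : ℕ, sTildeZ (m + k) * (shiftMinus τ).coeff k

/-- The coefficient of `z^m` in
`exp (-∑_{j>0 odd} t_j z^j) exp (2∑_{j>0 odd} (1/j)(∂/∂t_j) z^{-j}) τ`. -/
def rightCoeff (τ : BRing) (m : ℤ) : BRing :=
  ∑ᶠ k : ℕ, sTildeNegZ (m + k) * (shiftPlus τ).coeff k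

/-- `ℂ[t₁,t₃,…] ⊗ ℂ[t'₁,t'₃,…]`, realized as polynomials in two families of variables. -/
abbrev BRing2 : Type := MvPolynomial (ℕ ⊕ ℕ) ℂ

/-- The embedding `p(t) ↦ p(t) ∈ ℂ[t] ⊗ ℂ[t']` on the first factor. -/
def inL : BRing →+* BRing2 := (MvPolynomial.rename Sum.inl).toRingHom

/-- The embedding `p(t') ↦ p(t') ∈ ℂ[t] ⊗ ℂ[t']` on the second factor. -/
def inR : BRing →+* BRing2 := (MvPolynomial.rename Sum.inr).toRingHom

/-- The BKP bilinear identity on `τ ∈ ℂ[t₁,t₃,t₅,…]`: the coefficient of `z⁰` in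
`(exp(∑ t_j z^j) exp(-2∑ (1/j)∂_{t_j} z^{-j}) τ)(t) ·
 (exp(-∑ t'_j z^j) exp(2∑ (1/j)∂_{t'_j} z^{-j}) τ)(t')`
equals `τ(t) τ(t')` (all sums over odd `j > 0`; only finitely many summands below
are nonzero since `τ` is a polynomial). -/
def SatisfiesBKP (τ : BRing) : Prop :=
  ∑ᶠ m : ℤ, inL (leftCoeff τ m) * inR (rightCoeff τ (-m)) = inL τ * inR τ

/-- The MDKP bilinear identity on a pair `(τ₀, τ₁)`. -/
def SatisfiesMDKP (τ₀ τ₁ : BRing) : Prop :=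
  ∑ᶠ m : ℤ, inL (leftCoeff τ₀ m) * inR (rightCoeff τ₁ (-m)) = inL τ₁ * inR τ₀

/-- The condition on a permutation `σ` appearing in the definition of the Pfaffian:
`σ(2i-1) < σ(2i)` for all `i`, and `σ(1) < σ(3) < ⋯` (with 0-based indices here). -/
def pfaffianCond {m : ℕ} (σ : Equiv.Perm (Fin m)) : Prop :=
  (∀ i : Fin (m / 2),
      σ ⟨2 * i.val, by have := i.isLt; omega⟩ < σ ⟨2 * i.val + 1, by have := i.isLt; omega⟩) ∧
  (∀ i j : Fin (m / 2), i < j →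
      σ ⟨2 * i.val, by have := i.isLt; omega⟩ < σ ⟨2 * j.val, by have := j.isLt; omega⟩)

open scoped Classical in
/-- The Pfaffian `Pf(A) = ∑_σ sgn(σ) ∏_i a_{σ(2i-1),σ(2i)}` of a (skew-symmetric) matrix;
it is intended to be used for matrices of even size `m = 2n`. -/
def pfaffian {R : Type*} [CommRing R] {m : ℕ} (A : Matrix (Fin m) (Fin m) R) : R :=
  ∑ σ : Equiv.Perm (Fin m),
    if pfaffianCond σ then
      (Equiv.Perm.sign σ : ℤ) •
        ∏ i : Fin (m / 2),
          A (σ ⟨2 * i.val, by have := i.isLt; omega⟩)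
            (σ ⟨2 * i.val + 1, by have := i.isLt; omega⟩)
    else 0

/-- The skew-symmetric matrix with `(i,j)`-entry `f i j` for `i < j`. -/
def skewOf {R : Type*} [CommRing R] {m : ℕ} (f : Fin m → Fin m → R) :
    Matrix (Fin m) (Fin m) R :=
  Matrix.of fun i j => if i < j then f i j else if j < i then -f j i else 0

/-- `χ_{λ,μ}(c,c') = (1/2) s_λ(c) s_μ(c') + ∑_{ℓ=1}^{μ} (-1)^ℓ s_{λ+ℓ}(c) s_{μ-ℓ}(c')`,
for `λ > μ ≥ 0` and sequences `c, c'` of elements of `B`. -/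
def chiB (l μ : ℕ) (c c' : ℕ → BRing) : BRing :=
  (2 : ℂ)⁻¹ • (sB l c * sB μ c') +
    ∑ ℓ ∈ Finset.Icc 1 μ, ((-1 : ℂ) ^ ℓ) • (sB (l + ℓ) c * sB (μ - ℓ) c')

/-- The skew-symmetric matrix `( χ_{λ_i,λ_j}(t̃+c_i, t̃+c_j) )_{i,j}`. -/
def chiMatrix {m : ℕ} (lam : Fin m → ℕ) (c : Fin m → ℕ → ℂ) :
    Matrix (Fin m) (Fin m) BRing :=
  skewOf fun i j => chiB (lam i) (lam j) (tShift (c i)) (tShift (c j))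

/-- `√2` as a complex number. -/
def sqrt2 : ℂ := (Real.sqrt 2 : ℂ)

/-- `ρ_{λ,μ}(c,c';b,b') = (s_λ(c)/√2 - b)(s_μ(c')/√2 + b')
  + ∑_{ℓ=1}^{μ} (-1)^ℓ s_{λ+ℓ}(c) s_{μ-ℓ}(c')` for `λ > μ ≥ 0`. -/
def rhoB (l μ : ℕ) (c c' : ℕ → BRing) (b b' : ℂ) : BRing :=
  (sqrt2⁻¹ • sB l c - MvPolynomial.C b) * (sqrt2⁻¹ • sB μ c' + MvPolynomial.C b') +
    ∑ ℓ ∈ Finset.Icc 1 μ, ((-1 : ℂ) ^ ℓ) • (sB (l + ℓ) c * sB (μ - ℓ) c')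

/-- `ρ_λ(c;b) = s_λ(c)/√2 + b`. -/
def rho1B (l : ℕ) (c : ℕ → BRing) (b : ℂ) : BRing :=
  sqrt2⁻¹ • sB l c + MvPolynomial.C b

/-- The `2n × 2n` skew-symmetric matrix `( ρ_{λ_i,λ_j}(t̃+c_i, t̃+c_j; b_i, b_j) )_{i,j}`
(for an even number `m = 2n` of rows of `λ`). -/
def rhoMatrixEven {m : ℕ} (lam : Fin m → ℕ) (c : Fin m → ℕ → ℂ) (b : Fin m → ℂ) :
    Matrix (Fin m) (Fin m) BRing :=
  skewOf fun i j => rhoB (lam i) (lam j) (tShift (c i)) (tShift (c j)) (b i) (b j)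

/-- For an odd number `m` of parts `λ_1 > ⋯ > λ_m ≥ 0`, the `(m+1) × (m+1)`
skew-symmetric matrix with rows/columns indexed by `0, 1, …, m`, whose `(0,j)`-entry is
`ρ_{λ_j}(t̃+c_j; b_j)` and whose `(i,j)`-entry for `1 ≤ i < j` is
`ρ_{λ_i,λ_j}(t̃+c_i, t̃+c_j; b_i, b_j)`. -/
def rhoMatrixOdd {m : ℕ} (lam : Fin m → ℕ) (c : Fin m → ℕ → ℂ) (b : Fin m → ℂ) :
    Matrix (Fin (m + 1)) (Fin (m + 1)) BRing :=
  skewOf fun i j =>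
    if i.val = 0 then
      if hj : j.val = 0 then 0
      else
        rho1B (lam ⟨j.val - 1, by have := j.isLt; omega⟩)
          (tShift (c ⟨j.val - 1, by have := j.isLt; omega⟩))
          (b ⟨j.val - 1, by have := j.isLt; omega⟩)
    else
      if hj : j.val = 0 then 0
      else
        rhoB (lam ⟨i.val - 1, by have := i.isLt; omega⟩)
          (lam ⟨j.val - 1, by have := j.isLt; omega⟩)
          (tShift (c ⟨i.val - 1, by have := i.isLt; omega⟩))
          (tShift (c ⟨j.val - 1, by have := j.isLt; omega⟩))
          (b ⟨i.val - 1, by have := i.isLt; omega⟩)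
          (b ⟨j.val - 1, by have := j.isLt; omega⟩)

/-- The DKP tau-function `ρ_λ(t̃; c_1,…,c_k; b_1,…,b_k)` attached to an extended strict
partition `λ` with `k` parts: a Pfaffian of size `k` if `k` is even, and of size `k+1`
(with an extra 0-th row built from the `ρ_{λ_j}`) if `k` is odd. -/
def rhoTau {k : ℕ} (lam : Fin k → ℕ) (c : Fin k → ℕ → ℂ) (b : Fin k → ℂ) : BRing :=
  if k % 2 = 0 then pfaffian (rhoMatrixEven lam c b)
  else pfaffian (rhoMatrixOdd lam c b)

/-- The operators `φ̂_j` (`j ∈ ℤ`) on `B`, defined by the generating series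
`∑_{j∈ℤ} φ̂_j z^{-j} = (1/√2) exp(∑_{k>0 odd} t_k z^k) exp(-∑_{k>0 odd} (2/k) ∂_{t_k} z^{-k})`. -/
def phiHat (j : ℤ) (p : BRing) : BRing :=
  sqrt2⁻¹ • ∑ᶠ k : ℕ, sTildeZ ((k : ℤ) - j) * (shiftMinus p).coeff k

/-- `a : ℤ → ℂ` vanishes for all sufficiently negative indices. -/
def BddBelowSupport (a : ℤ → ℂ) : Prop := ∃ N : ℤ, ∀ j < N, a j = 0

/-- The operator `v = ∑_{j∈ℤ} a_j φ̂_j` on `B` (a finite sum on each polynomial,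
when `a` has support bounded below). -/
def vOp (a : ℤ → ℂ) (p : BRing) : BRing := ∑ᶠ j : ℤ, a j • phiHat j p

/-- Evaluation at `t = 0`, `ev₀ : B → ℂ` (the vacuum expectation value). -/
def ev0 : BRing → ℂ := MvPolynomial.eval (fun _ => 0)

/-- The "`√2` times `φ̂_j`" vertex operator coefficients (without the `1/√2` factor),
used for the type `D` construction. -/
def vertexB (j : ℤ) (p : BRing) : BRing :=
  ∑ᶠ k : ℕ, sTildeZ ((k : ℤ) - j) * (shiftMinus p).coeff k

/-- `B_D = ℂ[θ] ⊗ B` with `θ` a Grassmann variable: the pair `(p₀, p₁)` represents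
`p₀ + θ p₁`. -/
abbrev BD : Type := BRing × BRing

/-- The operators `Φ̂_j` (`j ∈ ℤ`) on `B_D`, defined by
`∑_j Φ̂_j z^{-j} = (1/√2)(θ + ∂/∂θ) exp(∑ t_k z^k) exp(-∑ (2/k) ∂_{t_k} z^{-k})`. -/
def PhiHatD (j : ℤ) (p : BD) : BD :=
  sqrt2⁻¹ • (vertexB j p.2, vertexB j p.1)

/-- `Ψ = (θ - ∂/∂θ)/√2` on `B_D`. -/
def PsiD (p : BD) : BD := sqrt2⁻¹ • (-p.2, p.1)

/-- The type `D` fermions `φ̂_a`, `a ∈ ½ + ℤ`, where the integer `m` encodes the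
half-integer index `a = m + ½`:  `φ̂_{-i-½} = Φ̂_{-i}` and `φ̂_{i+½} = (-1)^i Φ̂_i`
for `i ≥ 1`, `φ̂_{-½} = (Φ̂_0 + Ψ)/√2`, `φ̂_{½} = (Φ̂_0 - Ψ)/√2`. -/
def phiD (m : ℤ) (p : BD) : BD :=
  if m ≤ -2 then PhiHatD (m + 1) p
  else if m = -1 then sqrt2⁻¹ • (PhiHatD 0 p + PsiD p)
  else if m = 0 then sqrt2⁻¹ • (PhiHatD 0 p - PsiD p)
  else ((-1 : ℂ) ^ m) • PhiHatD m p

end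


noncomputable section DKPHelpers

open MvPolynomial

section SchurPart

variable {A : Type*} [CommRing A] [Algebra ℂ A]

/-- `s_n(c)` in a commutative algebra. -/
def sN (n : ℕ) (c : ℕ → A) : A := MvPolynomial.aeval c (schurPoly n)

/-- `s_m(c)` for integer `m`. -/
def sZ (m : ℤ) (c : ℕ → A) : A := if 0 ≤ m then sN m.toNat c else 0

lemma sN_zero (c : ℕ → A) : sN 0 c = 1 := by
  simp [sN, schurPoly]

lemma sN_succ (n : ℕ) (c : ℕ → A) :
    ((n : A) + 1) * sN (n + 1) c =
      ∑ j ∈ Finset.range (n + 1), ((j : A) + 1) * (c (j + 1) * sN (n - j) c) := by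
  have hn : (n + 1 : ℂ) ≠ 0 := by exact_mod_cast Nat.succ_ne_zero n
  have e : ∀ k : ℕ, ((k : A) + 1) = algebraMap ℂ A (k + 1) := by intro k; simp
  unfold sN
  rw [schurPoly, e, ← Algebra.smul_def, map_smul, smul_smul, mul_inv_cancel₀ hn, one_smul, map_sum]
  refine Finset.sum_congr rfl fun j _ => ?_
  rw [e, ← Algebra.smul_def, map_smul, map_mul, aeval_X]

lemma natCast_succ_cancel (n : ℕ) {x y : A} (h : ((n : A) + 1) * x = ((n : A) + 1) * y) : x = y := by
  have hn : (n + 1 : ℂ) ≠ 0 := by exact_mod_cast Nat.succ_ne_zero n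
  have e : ((n : A) + 1) = algebraMap ℂ A (n + 1) := by simp
  rw [e, ← Algebra.smul_def, ← Algebra.smul_def] at h
  have := congrArg (fun z => ((n + 1 : ℂ)⁻¹) • z) h
  simpa [smul_smul, inv_mul_cancel₀ hn] using this

lemma sN_unique (c : ℕ → A) (a : ℕ → A) (h0 : a 0 = 1)
    (h : ∀ n : ℕ, ((n : A) + 1) * a (n + 1) =
      ∑ j ∈ Finset.range (n + 1), ((j : A) + 1) * (c (j + 1) * a (n - j))) :
    ∀ n, a n = sN n c := by
  intro n
  induction n using Nat.strong_induction_on with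
  | _ n ih =>
    cases n with
    | zero => rw [h0, sN_zero]
    | succ n =>
      apply natCast_succ_cancel n
      rw [h, sN_succ]
      refine Finset.sum_congr rfl fun j hj => ?_
      rw [ih (n - j) (by omega)]

lemma sN_add (c d : ℕ → A) (n : ℕ) :
    sN n (fun j => c j + d j) = ∑ k ∈ Finset.range (n + 1), sN k c * sN (n - k) d := by
  let G : (ℕ → A) → PowerSeries A := fun c => PowerSeries.mk fun n => sN n c
  let D : (ℕ → A) → PowerSeries A := fun c => PowerSeries.mk fun n => ((n : A) + 1) * c (n + 1)
  have hG : ∀ c, PowerSeries.derivative A (G c) = D c * G c := by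
    intro c
    ext n
    rw [PowerSeries.coeff_derivative, PowerSeries.coeff_mul,
      Finset.Nat.sum_antidiagonal_eq_sum_range_succ_mk]
    simp only [G, D, PowerSeries.coeff_mk]
    rw [mul_comm, sN_succ]
    refine Finset.sum_congr rfl fun j _ => by ring
  have hP : PowerSeries.derivative A (G c * G d) = D (fun j => c j + d j) * (G c * G d) := by
    have : D (fun j => c j + d j) = D c + D d := by
      ext n; simp [D, mul_add]
    rw [Derivation.leibniz, hG, hG, this, smul_eq_mul, smul_eq_mul]
    ring
  have key := sN_unique (fun j => c j + d j) (fun n => PowerSeries.coeff n (G c * G d))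
    (by simp [G, sN_zero, PowerSeries.coeff_mul])
    (by
      intro n
      have := congrArg (PowerSeries.coeff n) hP
      rw [PowerSeries.coeff_derivative, PowerSeries.coeff_mul n (D fun j => c j + d j),
        Finset.Nat.sum_antidiagonal_eq_sum_range_succ_mk] at this
      rw [mul_comm, this]
      refine Finset.sum_congr rfl fun j _ => by simp [D]; ring) n
  rw [← key, PowerSeries.coeff_mul, Finset.Nat.sum_antidiagonal_eq_sum_range_succ_mk]
  simp [G]

lemma sN_map {A' : Type*} [CommRing A'] [Algebra ℂ A'] (f : A →ₐ[ℂ] A') (n : ℕ) (c : ℕ → A) :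
    f (sN n c) = sN n (fun j => f (c j)) := by
  unfold sN
  exact MvPolynomial.comp_aeval_apply _ f _

lemma sZ_map {A' : Type*} [CommRing A'] [Algebra ℂ A'] (f : A →ₐ[ℂ] A') (n : ℤ) (c : ℕ → A) :
    f (sZ n c) = sZ n (fun j => f (c j)) := by
  unfold sZ
  split_ifs
  · exact sN_map f _ c
  · simp

lemma sN_homog (w : A) (c : ℕ → A) (n : ℕ) : sN n (fun j => w ^ j * c j) = w ^ n * sN n c := by
  symm
  refine sN_unique _ (fun n => w ^ n * sN n c) (by simp [sN_zero]) (fun n => ?_) n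
  have := sN_succ n c
  calc _ = w ^ (n + 1) * (((n : A) + 1) * sN (n + 1) c) := by ring
    _ = _ := by
      rw [this, Finset.mul_sum]
      refine Finset.sum_congr rfl fun j hj => ?_
      have : n + 1 = (j + 1) + (n - j) := by have := Finset.mem_range.1 hj; omega
      have e : w ^ (n + 1) = w ^ (j + 1) * w ^ (n - j) := by rw [← pow_add, ← this]
      rw [e]
      ring

lemma sN_zero_seq (n : ℕ) : sN n (fun _ => (0 : A)) = if n = 0 then 1 else 0 := by
  cases n with
  | zero => simp [sN_zero]
  | succ n =>
    apply natCast_succ_cancel n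
    rw [sN_succ]; simp

lemma sZ_of_nonneg (n : ℕ) (c : ℕ → A) : sZ (n : ℤ) c = sN n c := by simp [sZ]

lemma sZ_of_neg {m : ℤ} (h : m < 0) (c : ℕ → A) : sZ m c = 0 := by simp [sZ, not_le.2 h]

lemma sZ_add (c d : ℕ → A) (m : ℤ) (K : ℕ) (hK : m < K) :
    sZ m (fun j => c j + d j) = ∑ n ∈ Finset.range K, sN n c * sZ (m - n) d := by
  rcases lt_or_ge m 0 with h | h
  · rw [sZ_of_neg h, Finset.sum_eq_zero]
    intro n _
    rw [sZ_of_neg (by omega), mul_zero]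
  · lift m to ℕ using h
    rw [sZ_of_nonneg, sN_add]
    have hK' : m + 1 ≤ K := by omega
    rw [← Finset.sum_range_add_sum_Ico _ hK']
    rw [Finset.sum_eq_zero (s := Finset.Ico _ _), add_zero]
    · refine Finset.sum_congr rfl fun j hj => ?_
      have := Finset.mem_range.1 hj
      rw [← sZ_of_nonneg (m - j), Nat.cast_sub (by omega)]
    · intro n hn
      have := Finset.mem_Ico.1 hn
      rw [sZ_of_neg (by omega), mul_zero]

lemma sZ_rec (c : ℕ → A) (m : ℤ) (K : ℕ) (hK : m ≤ K) :
    (m : A) * sZ m c = ∑ j ∈ Finset.range K, ((j : A) + 1) * (c (j + 1) * sZ (m - 1 - j) c) := by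
  rcases le_or_gt m 0 with h | h
  · rw [Finset.sum_eq_zero]
    · rcases h.eq_or_lt with h | h
      · simp [h]
      · simp [sZ_of_neg h]
    · intro n _
      rw [sZ_of_neg (by omega), mul_zero, mul_zero]
  · obtain ⟨n, rfl⟩ : ∃ n : ℕ, m = n + 1 := ⟨(m - 1).toNat, by omega⟩
    have hK' : n + 1 ≤ K := by omega
    rw [← Finset.sum_range_add_sum_Ico _ hK']
    rw [Finset.sum_eq_zero (s := Finset.Ico _ _), add_zero]
    · have := sN_succ n c
      rw [← sZ_of_nonneg] at this
      push_cast at this ⊢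
      rw [this]
      refine Finset.sum_congr rfl fun j hj => ?_
      have := Finset.mem_range.1 hj
      rw [← sZ_of_nonneg (n - j), Nat.cast_sub (by omega)]
      congr 4; ring
    · intro j hj
      have := Finset.mem_Ico.1 hj
      rw [sZ_of_neg (by omega), mul_zero, mul_zero]

lemma sZ_deriv (d : Derivation ℂ A A) (c : ℕ → A) (r : ℕ)
    (hd : ∀ j, d (c (j + 1)) = if j = r then 1 else 0) (m : ℤ) :
    d (sZ m c) = sZ (m - (r + 1)) c := by
  rcases lt_or_ge m 0 with h | h
  · rw [sZ_of_neg h, sZ_of_neg (by omega), map_zero]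
  · lift m to ℕ using h
    induction m using Nat.strong_induction_on with
    | _ m ih =>
      cases m with
      | zero =>
        rw [sZ_of_nonneg, sN_zero, sZ_of_neg (by push_cast; omega)]
        simp
      | succ m =>
        apply natCast_succ_cancel m
        have h1 := sZ_rec c ((m + 1 : ℕ) : ℤ) (m + 1 + r + 1) (by push_cast; omega)
        have h2 := sZ_rec c ((m + 1 : ℕ) - ((r : ℤ) + 1)) (m + 1 + r + 1) (by push_cast; omega)
        have h3 := congrArg d h1
        have dn : ∀ k : ℕ, d ((k : A) + 1) = 0 := by intro k; simp
        have e1 : (((m + 1 : ℕ) : ℤ) : A) = (m : A) + 1 := by push_cast; rfl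
        rw [e1, Derivation.leibniz, dn, smul_zero, add_zero, smul_eq_mul] at h3
        rw [h3, map_sum]
        have : ∀ j ∈ Finset.range (m + 1 + r + 1),
            d (((j : A) + 1) * (c (j + 1) * sZ (((m + 1 : ℕ) : ℤ) - 1 - j) c)) =
            ((j : A) + 1) * (c (j + 1) * sZ ((((m + 1 : ℕ) : ℤ) - (r + 1)) - 1 - j) c) +
            if j = r then ((j : A) + 1) * sZ (((m + 1 : ℕ) : ℤ) - 1 - j) c else 0 := by
          intro j hj
          have hder : d (sZ (((m + 1 : ℕ) : ℤ) - 1 - j) c)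
              = sZ ((((m + 1 : ℕ) : ℤ) - (r + 1)) - 1 - j) c := by
            rcases le_or_gt j m with hj' | hj'
            · have := ih (m - j) (by omega)
              rw [Nat.cast_sub hj'] at this
              have e3 : ((m + 1 : ℕ) : ℤ) - 1 - j = m - j := by push_cast; ring
              have e4 : ((m + 1 : ℕ) : ℤ) - (r + 1) - 1 - j = m - j - (r + 1) := by push_cast; ring
              rw [e3, e4, this]
            · rw [sZ_of_neg (by push_cast; omega), sZ_of_neg (by push_cast; omega), map_zero]
          rw [Derivation.leibniz, dn, smul_zero, add_zero, Derivation.leibniz, hder, hd]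
          simp only [smul_eq_mul]
          split_ifs <;> ring
        rw [Finset.sum_congr rfl this, Finset.sum_add_distrib, ← h2, Finset.sum_ite_eq' ,
          if_pos (by simp)]
        have e2 : ((m + 1 : ℕ) : ℤ) - 1 - r = ((m + 1 : ℕ) : ℤ) - (r + 1) := by ring
        rw [e2]
        push_cast
        ring

lemma exists_sN_eq (a : ℕ → ℂ) (h0 : a 0 = 1) : ∃ c : ℕ → ℂ, ∀ n, sN n c = a n := by
  let c : ℕ → ℂ := fun n => Nat.strongRecOn n fun n ih =>
    ((n : ℂ))⁻¹ * ((n : ℂ) * a n - ∑ j : Fin (n - 1), ((j : ℂ) + 1) *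
      (ih (j + 1) (by have := j.isLt; omega) * a (n - 1 - j)))
  have hc : ∀ n, c n = ((n : ℂ))⁻¹ * ((n : ℂ) * a n - ∑ j : Fin (n - 1), ((j : ℂ) + 1) *
      (c (j + 1) * a (n - 1 - j))) := by
    intro n
    simp only [c]
    rw [Nat.strongRecOn_eq]
  refine ⟨c, fun n => (sN_unique c a h0 (fun n => ?_) n).symm⟩
  have hn : (n + 1 : ℂ) ≠ 0 := by exact_mod_cast Nat.succ_ne_zero n
  rw [Finset.sum_range_succ, hc (n + 1)]
  simp only [Nat.add_sub_cancel, Nat.sub_self, h0]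
  rw [Finset.sum_range (n := n)]
  push_cast
  rw [mul_one, mul_inv_cancel_left₀ hn]
  exact (add_sub_cancel _ _).symm

/-- The sequence `-2/j` for `j` odd, `0` for `j` even. -/
def qSeq : ℕ → ℂ := fun j => if j % 2 = 1 then -2 / (j : ℂ) else 0

lemma sN_qSeq (n : ℕ) : sN n qSeq = if n = 0 then 1 else 2 * (-1) ^ n := by
  have hj : ∀ j : ℕ, ((j : ℂ) + 1) ≠ 0 := fun j => by exact_mod_cast Nat.succ_ne_zero j
  have h1 : ∀ n, (-1 : ℂ) ^ n = sN n (fun j => (-1) ^ j / (j : ℂ)) := by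
    refine sN_unique _ _ (by simp) fun n => ?_
    have : ∀ j ∈ Finset.range (n + 1), ((j : ℂ) + 1) * ((-1) ^ (j + 1) / ((j + 1 : ℕ) : ℂ) *
        (-1) ^ (n - j)) = (-1) ^ (n + 1) := by
      intro j hjm
      have h2 : n + 1 = j + 1 + (n - j) := by have := Finset.mem_range.1 hjm; omega
      have e : (-1 : ℂ) ^ (n + 1) = (-1) ^ (j + 1) * (-1) ^ (n - j) := by rw [← pow_add, ← h2]
      rw [e]
      have := hj j
      push_cast
      field_simp
    rw [Finset.sum_congr rfl this]
    simp
  have h2 : ∀ n, (if n = 0 then (1 : ℂ) else if n = 1 then -1 else 0) =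
      sN n (fun j => -1 / (j : ℂ)) := by
    refine sN_unique _ _ (by simp) fun n => ?_
    have : ∀ j ∈ Finset.range (n + 1), ((j : ℂ) + 1) * (-1 / ((j + 1 : ℕ) : ℂ) *
        (if n - j = 0 then (1 : ℂ) else if n - j = 1 then -1 else 0)) =
          (if j = n then -1 else 0) + (if j + 1 = n then 1 else 0) := by
      intro j hjm
      have := hj j
      have hjn := Finset.mem_range.1 hjm
      push_cast
      split_ifs <;> first | omega | (field_simp; simp)
    rw [Finset.sum_congr rfl this, Finset.sum_add_distrib]
    cases n with
    | zero => simp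
    | succ n => simp
  have hq : qSeq = fun j : ℕ => (-1 : ℂ) / (j : ℂ) + (-1) ^ j / (j : ℂ) := by
    funext j
    unfold qSeq
    rcases Nat.even_or_odd j with h | h
    · rw [if_neg (by have := Nat.even_iff.1 h; omega), h.neg_one_pow]; ring
    · rw [if_pos (Nat.odd_iff.1 h), h.neg_one_pow]; ring
  rw [hq, sN_add]
  simp only [← h1, ← h2]
  cases n with
  | zero => simp
  | succ n =>
    rw [Finset.sum_range_succ', Finset.sum_range_succ']
    simp [pow_succ]
    ring

end SchurPart

end DKPHelpers


noncomputable section DKPHelpers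

open MvPolynomial

/-- Evaluation at `0` as an algebra map. -/
def e0 : BRing →ₐ[ℂ] ℂ := MvPolynomial.aeval (fun _ => 0)

/-- `shiftMinus` as an algebra map. -/
def shA : BRing →ₐ[ℂ] Polynomial BRing :=
  MvPolynomial.aeval
    (fun i => Polynomial.C (MvPolynomial.X i) -
      Polynomial.C (MvPolynomial.C ((2 : ℂ) / ((2 * i + 1 : ℕ) : ℂ))) *
        Polynomial.X ^ (2 * i + 1))

lemma shiftMinus_eq (p : BRing) : shiftMinus p = shA p := rfl

lemma shA_X (i : ℕ) : shA (X i) = Polynomial.C (MvPolynomial.X i) -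
      Polynomial.C (MvPolynomial.C ((2 : ℂ) / ((2 * i + 1 : ℕ) : ℂ))) *
        Polynomial.X ^ (2 * i + 1) := by simp [shA]

lemma shA_C (a : ℂ) : shA (C a) = Polynomial.C (C a) := by
  simp only [shA, aeval_C]; rfl

/-- Pairing of a sequence with a polynomial. -/
def pairG (g : ℕ → BRing) : Polynomial BRing →ₗ[ℂ] BRing :=
  Polynomial.lsum fun k => LinearMap.mulLeft ℂ (g k)

lemma pairG_monomial (g : ℕ → BRing) (n : ℕ) (a : BRing) :
    pairG g (Polynomial.monomial n a) = g n * a := by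
  simp [pairG, Polynomial.lsum, Polynomial.sum_monomial_index]

lemma pairG_C_mul (g : ℕ → BRing) (a : BRing) (q : Polynomial BRing) :
    pairG g (Polynomial.C a * q) = a * pairG g q := by
  induction q using Polynomial.induction_on' with
  | add p q hp hq => rw [mul_add, map_add, map_add, hp, hq, mul_add]
  | monomial n b => rw [Polynomial.C_mul_monomial, pairG_monomial, pairG_monomial]; ring

lemma pairG_X_pow_mul (g : ℕ → BRing) (r : ℕ) (q : Polynomial BRing) :
    pairG g (Polynomial.X ^ r * q) = pairG (fun k => g (k + r)) q := by
  induction q using Polynomial.induction_on' with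
  | add p q hp hq => rw [mul_add, map_add, map_add, hp, hq]
  | monomial n b =>
    rw [Polynomial.X_pow_mul_monomial, pairG_monomial, pairG_monomial]

lemma pairG_eq (g : ℕ → BRing) (q : Polynomial BRing) (K : ℕ) (hK : q.natDegree < K) :
    pairG g q = ∑ k ∈ Finset.range K, g k * q.coeff k := by
  conv_lhs => rw [q.as_sum_range' K hK]
  rw [map_sum]
  exact Finset.sum_congr rfl fun k _ => pairG_monomial _ _ _

/-- The twisted vertex operator coefficients. -/
def VO (b : ℤ) (c : ℕ → ℂ) : BRing →ₗ[ℂ] BRing :=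
  (pairG fun k => sZ (b + k) (tShift c)).comp shA.toLinearMap

lemma VO_eq (b : ℤ) (c : ℕ → ℂ) (p : BRing) (K : ℕ) (hK : (shA p).natDegree < K) :
    VO b c p = ∑ k ∈ Finset.range K, sZ (b + k) (tShift c) * (shA p).coeff k :=
  pairG_eq _ _ _ hK

lemma VO_one (b : ℤ) (c : ℕ → ℂ) : VO b c 1 = sZ b (tShift c) := by
  rw [VO_eq b c 1 1 (by simp)]
  simp

lemma VO_X (b : ℤ) (c : ℕ → ℂ) (k : ℕ) (p : BRing) :
    VO b c (X k * p) = X k * VO b c p -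
      C ((2 : ℂ) / ((2 * k + 1 : ℕ) : ℂ)) * VO (b + (2 * k + 1 : ℕ)) c p := by
  simp only [VO, LinearMap.comp_apply, AlgHom.toLinearMap_apply]
  rw [map_mul, shA_X, sub_mul, map_sub, pairG_C_mul, mul_assoc, pairG_C_mul, pairG_X_pow_mul]
  congr 3
  congr 1
  funext j
  congr 1
  push_cast
  ring

lemma pderiv_shA (k : ℕ) (p : BRing) (j : ℕ) :
    pderiv k ((shA p).coeff j) = (shA (pderiv k p)).coeff j := by
  induction p using MvPolynomial.induction_on generalizing j with
  | C a => rw [shA_C]; simp [Polynomial.coeff_C]; split_ifs <;> simp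
  | add p q hp hq => simp [hp, hq]
  | mul_X p i hp =>
    rw [Derivation.leibniz, map_mul, map_add, smul_eq_mul, smul_eq_mul, map_mul, map_mul, shA_X,
      pderiv_X]
    have e : ∀ (q : Polynomial BRing) j, (q * (Polynomial.C (X i : BRing) -
      Polynomial.C (MvPolynomial.C ((2 : ℂ) / ((2 * i + 1 : ℕ) : ℂ))) *
        Polynomial.X ^ (2 * i + 1))).coeff j = q.coeff j * X i -
        C ((2 : ℂ) / ((2 * i + 1 : ℕ) : ℂ)) *
          (if 2 * i + 1 ≤ j then q.coeff (j - (2 * i + 1)) else 0) := by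
      intro q j
      rw [mul_sub, Polynomial.coeff_sub, Polynomial.coeff_mul_C, mul_left_comm,
        Polynomial.coeff_C_mul, Polynomial.coeff_mul_X_pow']
    rw [e, mul_comm _ (shA (pderiv k p)), Polynomial.coeff_add, e, map_sub, Derivation.leibniz,
      hp, pderiv_C_mul, pderiv_X]
    by_cases h : i = k
    · subst h
      simp
      split_ifs
      · rw [hp]; ring
      · simp; ring
    · simp [h]
      split_ifs
      · rw [hp]; ring
      · simp; ring

lemma pderiv_tShift (k : ℕ) (c : ℕ → ℂ) (j : ℕ) :
    pderiv k (tShift c (j + 1)) = if j = 2 * k then 1 else 0 := by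
  unfold tShift tTilde
  rw [map_add, pderiv_C, add_zero]
  split_ifs with h1 h2 h2
  · rw [pderiv_X, h2]; simp
  · rw [pderiv_X, Pi.single_apply, if_neg (by omega)]
  · omega
  · simp

lemma VO_pderiv (b : ℤ) (c : ℕ → ℂ) (k : ℕ) (p : BRing) :
    pderiv k (VO b c p) = VO (b - (2 * k + 1 : ℕ)) c p + VO b c (pderiv k p) := by
  set K := max (shA p).natDegree (shA (pderiv k p)).natDegree + 1
  rw [VO_eq b c p K (by omega), VO_eq _ c p K (by omega), VO_eq _ c _ K (by omega), map_sum,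
    ← Finset.sum_add_distrib]
  refine Finset.sum_congr rfl fun j _ => ?_
  rw [Derivation.leibniz, pderiv_shA, sZ_deriv (pderiv k) (tShift c) (2 * k) (pderiv_tShift k c)]
  simp only [smul_eq_mul]
  have : b + (j : ℤ) - ((2 * k : ℕ) + 1) = b - (2 * k + 1 : ℕ) + j := by push_cast; ring
  rw [this]
  ring

lemma e0_tShift (c : ℕ → ℂ) (j : ℕ) : e0 (tShift c j) = c j := by
  unfold tShift tTilde e0
  split_ifs <;> simp

lemma e0_sZ (m : ℤ) (c : ℕ → ℂ) : e0 (sZ m (tShift c)) = sZ m c := by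
  rw [sZ_map]; simp only [e0_tShift]

lemma e0_VO (b : ℤ) (c : ℕ → ℂ) (p : BRing) (K : ℕ) (hK : (shA p).natDegree < K) :
    e0 (VO b c p) = ∑ k ∈ Finset.range K, sZ (b + k) c * e0 ((shA p).coeff k) := by
  rw [VO_eq b c p K hK, map_sum]
  refine Finset.sum_congr rfl fun k _ => ?_
  rw [map_mul, e0_sZ]

lemma e0_shA_sZ (a : ℤ) (c : ℕ → ℂ) (n : ℕ) :
    e0 ((shA (sZ a (tShift c))).coeff n) = sN n qSeq * sZ (a - n) c := by
  let F : BRing →ₐ[ℂ] Polynomial ℂ := (Polynomial.mapAlgHom e0).comp shA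
  have hF : ∀ p n, e0 ((shA p).coeff n) = (F p).coeff n := by
    intro p n
    simp [F, Polynomial.coeff_map]
  have hFt : ∀ j, F (tShift c j) =
      Polynomial.X ^ j * Polynomial.C (qSeq j) + Polynomial.C (c j) := by
    intro j
    have hC : F (C (c j)) = Polynomial.C (c j) := by
      simp [F, e0]
    unfold tShift tTilde
    rw [map_add, hC]
    congr 1
    unfold qSeq
    split_ifs with h
    · have : 2 * ((j - 1) / 2) + 1 = j := by omega
      have hX : F (X ((j - 1) / 2)) = - (Polynomial.C ((2 : ℂ) / ((2 * ((j - 1) / 2) + 1 : ℕ) : ℂ))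
          * Polynomial.X ^ (2 * ((j - 1) / 2) + 1)) := by
        simp only [F, AlgHom.comp_apply, shA_X]
        simp [e0]
      rw [hX, this, neg_div, Polynomial.C_neg]
      ring
    · simp
  rw [hF, sZ_map]
  simp only [hFt]
  have hq : ∀ m, sN m (fun j => Polynomial.X ^ j * Polynomial.C (qSeq j)) =
      Polynomial.X ^ m * Polynomial.C (sN m qSeq) := by
    intro m
    rw [sN_homog Polynomial.X (fun j => Polynomial.C (qSeq j)) m]
    congr 1
    exact (sN_map (Algebra.ofId ℂ (Polynomial ℂ)) m qSeq).symm
  have hz : ∀ m, sZ m (fun j => Polynomial.C (c j)) = Polynomial.C (sZ m c) := fun m =>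
    (sZ_map (Algebra.ofId ℂ (Polynomial ℂ)) m c).symm
  rw [sZ_add _ _ a (a.toNat + n + 1) (by omega)]
  simp only [hq, hz, mul_assoc, ← Polynomial.C_mul]
  rw [Polynomial.finsetSum_coeff]
  simp only [Polynomial.coeff_X_pow_mul', Polynomial.coeff_C]
  rw [Finset.sum_eq_single n]
  · simp
  · intro m _ hm
    split_ifs with h1 h2
    · omega
    · rfl
    · rfl
  · intro h; simp at h

/-- The untwisted vertex operator coefficients. -/
abbrev LO (a : ℤ) : BRing →ₗ[ℂ] BRing := VO a (fun _ => 0)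

lemma sZ_zero_seq (m : ℤ) : sZ m (fun _ => (0 : ℂ)) = if m = 0 then 1 else 0 := by
  unfold sZ
  rw [sN_zero_seq]
  split_ifs <;> first | rfl | omega

lemma coeff_zero_of_closed (S : Set BRing) (hS : ∀ p ∈ S, e0 p = 0)
    (hd : ∀ p ∈ S, ∀ k, pderiv k p ∈ AddSubgroup.closure S) : ∀ p ∈ S, p = 0 := by
  have hS' : ∀ p ∈ AddSubgroup.closure S, e0 p = 0 ∧
      ∀ k, pderiv k p ∈ AddSubgroup.closure S := by
    intro p hp
    induction hp using AddSubgroup.closure_induction with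
    | mem x hx => exact ⟨hS x hx, hd x hx⟩
    | zero => simp [zero_mem]
    | add x y _ _ h1 h2 =>
      exact ⟨by simp [h1.1, h2.1], fun k => by rw [map_add]; exact add_mem (h1.2 k) (h2.2 k)⟩
    | neg x _ h1 => exact ⟨by simp [h1.1], fun k => by rw [map_neg]; exact neg_mem (h1.2 k)⟩
  have key : ∀ n : ℕ, ∀ e : ℕ →₀ ℕ, e.degree = n → ∀ p ∈ AddSubgroup.closure S,
      coeff e p = 0 := by
    intro n
    induction n with
    | zero =>
      intro e he p hp
      have : e = 0 := (Finsupp.degree_eq_zero_iff e).1 he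
      have h := (hS' p hp).1
      rw [this, ← constantCoeff_eq]
      simpa [e0, aeval_def, eval₂_zero'_apply] using h
    | succ n ih =>
      intro e he p hp
      have : e ≠ 0 := by rintro rfl; simp at he
      obtain ⟨i, hi⟩ := Finsupp.ne_iff.1 this
      simp only [Finsupp.coe_zero, Pi.zero_apply] at hi
      have e1 : e - Finsupp.single i 1 + Finsupp.single i 1 = e :=
        tsub_add_cancel_of_le (by simpa using Nat.one_le_iff_ne_zero.2 hi)
      have h := coeff_pderiv (i := i) p (e - Finsupp.single i 1)
      rw [ih _ (by
        have := congrArg Finsupp.degree e1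
        rw [map_add, Finsupp.degree_single] at this
        omega) _ ((hS' p hp).2 i), e1] at h
      rcases mul_eq_zero.1 h.symm with h | h
      · exact h
      · exact absurd h (Nat.cast_add_one_ne_zero _)
  intro p hp
  ext e
  rw [key _ e rfl p (AddSubgroup.subset_closure hp), coeff_zero]

/-- The defect in the Clifford relation. -/
def Dfn (c : ℕ → ℂ) (a b : ℤ) (p : BRing) : BRing :=
  LO a (VO b c p) + VO b c (LO a p) - C (2 * (-1) ^ a * sZ (a + b) c) * p

lemma neg_one_zpow_add_odd (a : ℤ) (k : ℕ) :
    (-1 : ℂ) ^ (a + (2 * k + 1 : ℕ)) = - (-1) ^ a := by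
  rw [zpow_add₀ (by norm_num), zpow_natCast, pow_succ, pow_mul]; simp

lemma neg_one_zpow_sub_odd (a : ℤ) (k : ℕ) :
    (-1 : ℂ) ^ (a - (2 * k + 1 : ℕ)) = - (-1) ^ a := by
  have := neg_one_zpow_add_odd (a - (2 * k + 1 : ℕ)) k
  rw [sub_add_cancel] at this
  rw [this, neg_neg]

lemma VO_C_mul (b : ℤ) (c : ℕ → ℂ) (r : ℂ) (p : BRing) : VO b c (C r * p) = C r * VO b c p := by
  rw [← smul_eq_C_mul, map_smul, smul_eq_C_mul]

lemma Dfn_X (c : ℕ → ℂ) (a b : ℤ) (k : ℕ) (p : BRing) :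
    Dfn c a b (X k * p) = X k * Dfn c a b p - C ((2 : ℂ) / ((2 * k + 1 : ℕ) : ℂ)) *
      (Dfn c (a + (2 * k + 1 : ℕ)) b p + Dfn c a (b + (2 * k + 1 : ℕ)) p) := by
  unfold Dfn
  simp only [VO_X, map_sub, VO_C_mul]
  rw [neg_one_zpow_add_odd]
  have : a + (2 * k + 1 : ℕ) + b = a + (b + (2 * k + 1 : ℕ)) := by ring
  rw [this]
  simp only [mul_neg, neg_mul, C_neg]
  ring

lemma Dfn_pderiv (c : ℕ → ℂ) (a b : ℤ) (k : ℕ) (p : BRing) :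
    pderiv k (Dfn c a b p) = Dfn c a b (pderiv k p) +
      (Dfn c (a - (2 * k + 1 : ℕ)) b p + Dfn c a (b - (2 * k + 1 : ℕ)) p) := by
  unfold Dfn
  simp only [VO_pderiv, map_sub, map_add, pderiv_C_mul]
  rw [neg_one_zpow_sub_odd]
  have : a - (2 * k + 1 : ℕ) + b = a + (b - (2 * k + 1 : ℕ)) := by ring
  rw [this]
  simp only [mul_neg, neg_mul, C_neg]
  ring

lemma e0_C (r : ℂ) : e0 (C r) = r := by simp [e0]

lemma e0_Dfn_one (c : ℕ → ℂ) (a b : ℤ) : e0 (Dfn c a b 1) = 0 := by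
  unfold Dfn
  rw [map_sub, map_add, mul_one, e0_C, VO_one, VO_one]
  have h1 : e0 (LO a (sZ b (tShift c))) = if a ≤ 0 then sN a.natAbs qSeq * sZ (a + b) c else 0 := by
    rw [e0_VO _ _ _ ((shA (sZ b (tShift c))).natDegree + a.natAbs + 1) (by omega)]
    simp only [e0_shA_sZ, sZ_zero_seq]
    split_ifs with h
    · rw [Finset.sum_eq_single a.natAbs]
      · rw [if_pos (by omega), one_mul]
        congr 2; omega
      · intro k _ hk
        rw [if_neg (by omega), zero_mul]
      · intro h; simp at h
    · apply Finset.sum_eq_zero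
      intro k _
      rw [if_neg (by omega), zero_mul]
  have h2 : e0 (VO b c (sZ a (tShift fun _ => 0))) =
      if 0 ≤ a then sN a.natAbs qSeq * sZ (a + b) c else 0 := by
    rw [e0_VO _ _ _ ((shA (sZ a (tShift fun _ => 0))).natDegree + a.natAbs + 1) (by omega)]
    simp only [e0_shA_sZ, sZ_zero_seq]
    split_ifs with h
    · rw [Finset.sum_eq_single a.natAbs]
      · rw [if_pos (by omega), mul_one, mul_comm]
        congr 2; omega
      · intro k _ hk
        rw [if_neg (by omega), mul_zero, mul_zero]
      · intro h; simp at h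
    · apply Finset.sum_eq_zero
      intro k _
      rw [if_neg (by omega), mul_zero, mul_zero]
  have h3 : (-1 : ℂ) ^ a = (-1) ^ a.natAbs := by
    rcases Int.natAbs_eq a with h | h
    · conv_lhs => rw [h]
      rw [zpow_natCast]
    · conv_lhs => rw [h]
      rw [zpow_neg, zpow_natCast, ← inv_pow]; norm_num
  rw [h1, h2, sN_qSeq, h3]
  rcases lt_trichotomy a 0 with h | h | h
  · rw [if_pos h.le, if_neg (by omega), if_neg (by omega)]; ring
  · subst h; simp; ring
  · rw [if_neg (by omega), if_pos (by omega), if_neg (by omega)]; ring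

lemma Dfn_zero (c : ℕ → ℂ) (a b : ℤ) : Dfn c a b 0 = 0 := by simp [Dfn]

lemma Dfn_one (c : ℕ → ℂ) (a b : ℤ) : Dfn c a b 1 = 0 := by
  refine coeff_zero_of_closed {p | ∃ a b, p = Dfn c a b 1} ?_ ?_ _ ⟨a, b, rfl⟩
  · rintro _ ⟨a, b, rfl⟩
    exact e0_Dfn_one c a b
  · rintro _ ⟨a, b, rfl⟩ k
    rw [Dfn_pderiv, pderiv_one, Dfn_zero, zero_add]
    exact add_mem (AddSubgroup.subset_closure ⟨_, _, rfl⟩) (AddSubgroup.subset_closure ⟨_, _, rfl⟩)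

lemma Dfn_eq_zero (c : ℕ → ℂ) (p : BRing) : ∀ a b : ℤ, Dfn c a b p = 0 := by
  induction p using MvPolynomial.induction_on with
  | C r =>
    intro a b
    have := Dfn_one c a b
    have e : Dfn c a b (C r * 1) = C r * Dfn c a b 1 := by
      unfold Dfn
      rw [VO_C_mul, VO_C_mul, VO_C_mul, VO_C_mul]; ring
    rw [mul_one] at e
    rw [e, this, mul_zero]
  | add p q hp hq =>
    intro a b
    have : Dfn c a b (p + q) = Dfn c a b p + Dfn c a b q := by
      unfold Dfn; simp only [map_add]; ring
    rw [this, hp, hq, add_zero]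
  | mul_X p i hp =>
    intro a b
    rw [mul_comm, Dfn_X, hp, hp, hp]; simp

/-- The Clifford relation. -/
lemma clifford (c : ℕ → ℂ) (a b : ℤ) (p : BRing) :
    LO a (VO b c p) + VO b c (LO a p) = C (2 * (-1) ^ a * sZ (a + b) c) * p :=
  sub_eq_zero.1 (Dfn_eq_zero c p a b)

end DKPHelpers

noncomputable section DKPHelpers
open MvPolynomial

lemma tShift_zero : tShift (fun _ => 0) = tTilde := by
  funext j; simp [tShift]

lemma leftCoeff_eq (τ : BRing) (m : ℤ) : leftCoeff τ m = LO m τ := by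
  unfold leftCoeff
  rw [VO_eq _ _ _ _ (Nat.lt_succ_self _), tShift_zero]
  refine finsum_eq_finsetSum_of_support_subset _ ?_
  intro k hk
  rw [Function.mem_support] at hk
  rw [Finset.mem_coe, Finset.mem_range, Nat.lt_succ_iff]
  by_contra hlt
  apply hk
  rw [shiftMinus_eq, Polynomial.coeff_eq_zero_of_natDegree_lt (by omega), mul_zero]

lemma shiftPlus_coeff (p : BRing) (k : ℕ) : (shiftPlus p).coeff k = (-1) ^ k * (shA p).coeff k := by
  have h : shiftPlus p = (shA p).comp (Polynomial.C (-1) * Polynomial.X) := by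
    have e : (fun p => (shA p).comp (Polynomial.C (-1) * Polynomial.X)) =
      ((Polynomial.aeval (Polynomial.C (-1 : BRing) * Polynomial.X)).restrictScalars ℂ).comp shA := by
        funext p
        simp [Polynomial.aeval_def, Polynomial.comp]
    have := congrFun e p
    rw [this]
    congr 1
    unfold shiftPlus
    rw [← AlgHom.coe_toRingHom, ← AlgHom.coe_toRingHom] 
    congr 2
    apply MvPolynomial.algHom_ext
    intro i
    have := congrFun e (X i)
    rw [← this, shA_X]
    simp [pow_succ, pow_mul]
    rw [show (-1 * Polynomial.X * (-1 * Polynomial.X) : Polynomial BRing) =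
      Polynomial.X * Polynomial.X by ring]
    ring
  rw [h, Polynomial.comp_C_mul_X_coeff, mul_comm]

lemma sTildeNegZ_eq (m : ℤ) : sTildeNegZ m = (-1) ^ m.natAbs * sZ m tTilde := by
  unfold sTildeNegZ sZ
  split_ifs with h
  · have := sN_homog (-1 : BRing) tTilde m.toNat
    rw [show m.natAbs = m.toNat by omega, ← this]
    unfold sN
    congr 2
    funext j
    unfold tTilde
    split_ifs with hj
    · rw [Odd.neg_one_pow (Nat.odd_iff.2 hj)]; simp
    · simp
  · simp

lemma rightCoeff_eq (τ : BRing) (m : ℤ) : rightCoeff τ m = ((-1 : ℂ) ^ m) • LO m τ := by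
  unfold rightCoeff
  rw [VO_eq _ _ _ _ (Nat.lt_succ_self _), tShift_zero, Finset.smul_sum]
  rw [finsum_eq_finsetSum_of_support_subset (s := Finset.range ((shA τ).natDegree + 1))]
  · refine Finset.sum_congr rfl fun k _ => ?_
    rw [shiftPlus_coeff, sTildeNegZ_eq, smul_eq_C_mul]
    have : ((-1 : BRing) ^ (m + k).natAbs * (-1) ^ k) = C ((-1 : ℂ) ^ m) := by
      have e : ∀ n : ℕ, (-1 : BRing) ^ n = C ((-1 : ℂ) ^ n) := by intro n; simp
      rw [e, e, ← C_mul]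
      congr 1
      have h1 : (-1 : ℂ) ^ (m + k).natAbs = (-1) ^ (m + k) := by
        rcases Int.natAbs_eq (m + k) with h | h
        · conv_rhs => rw [h]
          rw [zpow_natCast]
        · conv_rhs => rw [h]
          rw [zpow_neg, zpow_natCast, ← inv_pow]; norm_num
      rw [h1, zpow_add₀ (by norm_num), mul_assoc, zpow_natCast, ← pow_add, ← two_mul, pow_mul]
      simp
    linear_combination (sZ (m + k) tTilde * (shA τ).coeff k) * this
  · intro k hk
    rw [Function.mem_support] at hk
    rw [Finset.mem_coe, Finset.mem_range, Nat.lt_succ_iff]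
    by_contra hlt
    apply hk
    rw [shiftPlus_coeff, Polynomial.coeff_eq_zero_of_natDegree_lt (by omega), mul_zero, mul_zero]

lemma LO_neg_eq_zero (b : ℤ) (c : ℕ → ℂ) (τ : BRing) (h : b + (shA τ).natDegree < 0) :
    VO b c τ = 0 := by
  rw [VO_eq _ _ _ _ (Nat.lt_succ_self _)]
  refine Finset.sum_eq_zero fun k hk => ?_
  rw [Finset.mem_range] at hk
  rw [sZ_of_neg (by omega), zero_mul]

/-- Bilinear identity, contracted with a functional. -/
def QP (τ : BRing) : Prop := ∃ M0 : ℕ, ∀ M : ℕ, M0 ≤ M → ∀ f : BRing →ₗ[ℂ] ℂ,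
  ∑ m ∈ Finset.Icc (-(M : ℤ)) M, ((-1 : ℂ) ^ m * f (LO (-m) τ)) • LO m τ = f τ • τ

open TensorProduct in
lemma QP_of_BKP (τ : BRing) (h : SatisfiesBKP τ) : QP τ := by
  refine ⟨(shA τ).natDegree, fun M hM f => ?_⟩
  unfold SatisfiesBKP at h
  rw [finsum_eq_finsetSum_of_support_subset (s := Finset.Icc (-(M : ℤ)) M)] at h
  · let Φ : BRing2 →ₐ[ℂ] BRing ⊗[ℂ] BRing :=
      MvPolynomial.aeval (Sum.elim (fun i => (X i : BRing) ⊗ₜ[ℂ] (1 : BRing))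
        (fun i => (1 : BRing) ⊗ₜ[ℂ] (X i : BRing)))
    have hL : ∀ p, Φ (inL p) = p ⊗ₜ 1 := by
      have : Φ.comp (rename Sum.inl) = Algebra.TensorProduct.includeLeft := by
        apply MvPolynomial.algHom_ext
        intro i
        simp [Φ]
      intro p
      exact DFunLike.congr_fun this p
    have hR : ∀ p, Φ (inR p) = 1 ⊗ₜ p := by
      have : Φ.comp (rename Sum.inr) = Algebra.TensorProduct.includeRight := by
        apply MvPolynomial.algHom_ext
        intro i
        simp [Φ]
      intro p
      exact DFunLike.congr_fun this p
    let Ψ : BRing ⊗[ℂ] BRing →ₗ[ℂ] BRing :=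
      (TensorProduct.rid ℂ BRing).toLinearMap.comp (LinearMap.lTensor BRing f)
    have hΨ : ∀ p q, Ψ (p ⊗ₜ q) = f q • p := by
      intro p q; simp [Ψ]
    have := congrArg (fun x => Ψ (Φ x)) h
    simp only [map_sum, map_mul, hL, hR, Algebra.TensorProduct.tmul_mul_tmul, one_mul, mul_one, hΨ]
      at this
    rw [← this]
    refine Finset.sum_congr rfl fun m _ => ?_
    rw [leftCoeff_eq, rightCoeff_eq, map_smul, smul_eq_mul]
    congr 2
    rw [zpow_neg, ← inv_zpow]; norm_num
  · intro m hm
    rw [Function.mem_support] at hm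
    rw [Finset.mem_coe, Finset.mem_Icc]
    by_contra hlt
    apply hm
    rw [leftCoeff_eq, rightCoeff_eq]
    rcases lt_or_ge m (-M) with h1 | h1
    · rw [LO_neg_eq_zero m _ _ (by omega), map_zero, zero_mul]
    · rw [LO_neg_eq_zero (-m) _ _ (by omega), smul_zero, map_zero, mul_zero]

lemma VO_eq_LO (b : ℤ) (c : ℕ → ℂ) (p : BRing) (K : ℕ) (hK : b + (shA p).natDegree < K) :
    VO b c p = ∑ n ∈ Finset.range K, sN n c • LO (b - n) p := by
  have e : ∀ n : ℕ, sN n c • LO (b - n) p = ∑ k ∈ Finset.range ((shA p).natDegree + 1),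
      sN n c • (sZ (b - n + k) tTilde * (shA p).coeff k) := by
    intro n
    rw [VO_eq _ _ _ _ (Nat.lt_succ_self _), tShift_zero, Finset.smul_sum]
  rw [VO_eq _ _ _ _ (Nat.lt_succ_self _), Finset.sum_congr rfl fun n _ => e n, Finset.sum_comm]
  refine Finset.sum_congr rfl fun k hk => ?_
  rw [Finset.mem_range] at hk
  have e2 : tShift c = fun j => (C (c j) : BRing) + tTilde j := by
    funext j; rw [tShift, add_comm]
  rw [e2, sZ_add _ _ _ K (by omega), Finset.sum_mul]
  refine Finset.sum_congr rfl fun n _ => ?_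
  have e3 : sN n (fun j => (C (c j) : BRing)) = C (sN n c) := by
    have := sN_map (Algebra.ofId ℂ BRing) n c
    exact this.symm
  rw [e3, smul_eq_C_mul, mul_assoc, show b + (k : ℤ) - n = b - n + k by ring]

end DKPHelpers

noncomputable section DKPHelpers
open MvPolynomial

lemma shA_coeff_zero (p : BRing) : (shA p).coeff 0 = p := by
  let F : BRing →ₐ[ℂ] BRing := ((Polynomial.aeval (0 : BRing)).restrictScalars ℂ).comp shA
  have h : F = AlgHom.id ℂ BRing := by
    apply MvPolynomial.algHom_ext
    intro i
    simp [F, shA_X]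
  have := DFunLike.congr_fun h p
  simp only [F, AlgHom.comp_apply, AlgHom.restrictScalars_apply, AlgHom.id_apply] at this
  rw [Polynomial.coeff_zero_eq_aeval_zero, this]

lemma derivative_shA (p : BRing) : ∃ K0 : ℕ, ∀ K ≥ K0, Polynomial.derivative (shA p) =
    -2 * ∑ k ∈ Finset.range K, Polynomial.X ^ (2 * k) * shA (pderiv k p) := by
  induction p using MvPolynomial.induction_on with
  | C a => exact ⟨0, fun K _ => by rw [shA_C]; simp⟩
  | add p q hp hq =>
    obtain ⟨K1, h1⟩ := hp
    obtain ⟨K2, h2⟩ := hq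
    refine ⟨max K1 K2, fun K hK => ?_⟩
    rw [map_add, Polynomial.derivative_add, h1 K (le_trans (le_max_left _ _) hK),
      h2 K (le_trans (le_max_right _ _) hK), ← mul_add, ← Finset.sum_add_distrib]
    simp only [map_add, mul_add]
  | mul_X p i hp =>
    obtain ⟨K1, h1⟩ := hp
    refine ⟨max K1 (i + 1), fun K hK => ?_⟩
    have hd : Polynomial.derivative (shA (X i)) = -2 * Polynomial.X ^ (2 * i) := by
      rw [shA_X]
      simp only [Polynomial.derivative_sub, Polynomial.derivative_C, Polynomial.derivative_C_mul,
        Polynomial.derivative_X_pow, zero_sub]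
      rw [← mul_assoc, ← Polynomial.C_mul]
      have : (C ((2 : ℂ) / ((2 * i + 1 : ℕ) : ℂ)) * ((2 * i + 1 : ℕ) : BRing)) = 2 := by
        have e : ((2 * i + 1 : ℕ) : BRing) = C ((2 * i + 1 : ℕ) : ℂ) := (map_natCast C _).symm
        rw [e, ← C_mul, div_mul_cancel₀ _ (Nat.cast_ne_zero.2 (Nat.succ_ne_zero _))]
        exact map_ofNat C 2
      rw [this, Nat.add_sub_cancel, show (Polynomial.C (2 : BRing)) = 2 from map_ofNat Polynomial.C 2]
      ring
    have hs : ∀ k, pderiv k (p * X i) = pderiv k p * X i + (if k = i then p else 0) := by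
      intro k
      rw [Derivation.leibniz, pderiv_X]
      simp only [smul_eq_mul, Pi.single_apply]
      split_ifs with h1 h2 h2 <;> first | (exfalso; omega) | ring
    rw [map_mul, Polynomial.derivative_mul, h1 K (le_trans (le_max_left _ _) hK), hd]
    simp only [hs, map_add, map_mul, mul_add, Finset.sum_add_distrib]
    have hi : i ∈ Finset.range K := by
      rw [Finset.mem_range]
      have := le_trans (le_max_right _ _) hK
      omega
    have : ∑ k ∈ Finset.range K, Polynomial.X ^ (2 * k) * shA (if k = i then p else 0) =
        Polynomial.X ^ (2 * i) * shA p := by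
      rw [Finset.sum_eq_single_of_mem i hi]
      · simp
      · intro b _ hb; simp [hb]
    rw [this]
    simp only [← mul_assoc, ← Finset.sum_mul]
    ring

lemma vac_natDegree (p : BRing) (hp : ∀ n : ℕ, 1 ≤ n → LO (-(n : ℤ)) p = 0) :
    (shA p).natDegree = 0 := by
  by_contra hd
  have := hp (shA p).natDegree (by omega)
  rw [VO_eq _ _ _ _ (Nat.lt_succ_self _), Finset.sum_range_succ, Finset.sum_eq_zero] at this
  · rw [zero_add, neg_add_cancel] at this
    have e : sZ 0 (tShift fun _ => 0) = 1 := by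
      have := sZ_of_nonneg 0 (tShift fun _ => 0)
      rw [sN_zero] at this
      exact_mod_cast this
    rw [e, one_mul, Polynomial.coeff_natDegree, Polynomial.leadingCoeff_eq_zero] at this
    rw [this] at hd
    simp at hd
  · intro k hk
    rw [Finset.mem_range] at hk
    rw [sZ_of_neg (by omega), zero_mul]

lemma vac_pderiv (p : BRing) (hp : ∀ n : ℕ, 1 ≤ n → LO (-(n : ℤ)) p = 0) (k : ℕ) :
    ∀ n : ℕ, 1 ≤ n → LO (-(n : ℤ)) (pderiv k p) = 0 := by
  intro n hn
  have := VO_pderiv (-(n : ℤ)) (fun _ => 0) k p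
  rw [hp n hn, map_zero, show -(n : ℤ) - (2 * k + 1 : ℕ) = -((n + (2 * k + 1) : ℕ) : ℤ) by
    push_cast; ring, hp _ (by omega), zero_add] at this
  exact this.symm

lemma vac_const (p : BRing) (hp : ∀ n : ℕ, 1 ≤ n → LO (-(n : ℤ)) p = 0) : p = C (coeff 0 p) := by
  have h0 : ∀ q : BRing, (∀ n : ℕ, 1 ≤ n → LO (-(n : ℤ)) q = 0) → shA q = Polynomial.C q := by
    intro q hq
    rw [Polynomial.eq_C_of_natDegree_eq_zero (vac_natDegree q hq), shA_coeff_zero]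
  have hd : ∀ k, pderiv k p = 0 := by
    intro k
    obtain ⟨K0, hK0⟩ := derivative_shA p
    have := hK0 (max K0 (k + 1)) (le_max_left _ _)
    rw [h0 p hp, Polynomial.derivative_C] at this
    have h2 : ∑ j ∈ Finset.range (max K0 (k + 1)), Polynomial.X ^ (2 * j) * shA (pderiv j p) = 0 := by
      rcases mul_eq_zero.1 this.symm with h | h
      · exfalso
        have h3 : (2 : Polynomial BRing) = 0 := neg_eq_zero.1 h
        exact two_ne_zero h3
      · exact h
    have h3 := congrArg (fun q => Polynomial.coeff q (2 * k)) h2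
    simp only [Polynomial.finsetSum_coeff, h0 _ (vac_pderiv p hp _), Polynomial.coeff_zero] at h3
    rw [Finset.sum_eq_single_of_mem k] at h3
    · simpa [Polynomial.coeff_X_pow] using h3
    · rw [Finset.mem_range]; have := le_max_right K0 (k + 1); omega
    · intro b _ hb
      rw [Polynomial.coeff_mul_C, Polynomial.coeff_X_pow, if_neg (by omega), zero_mul]
  ext e
  rw [coeff_C]
  split_ifs with he
  · rw [he]
  · have : ∃ i, e i ≠ 0 := by
      by_contra hh
      push Not at hh
      exact he (Finsupp.ext fun i => by simp [hh i])
    obtain ⟨i, hi⟩ := this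
    have h1 := coeff_pderiv (i := i) p (e - Finsupp.single i 1)
    rw [hd i, coeff_zero] at h1
    have h2 : e - Finsupp.single i 1 + Finsupp.single i 1 = e :=
      tsub_add_cancel_of_le (by simpa using Nat.one_le_iff_ne_zero.2 hi)
    rw [h2] at h1
    rcases mul_eq_zero.1 h1.symm with h | h
    · exact h
    · exfalso
      exact Nat.cast_add_one_ne_zero _ h

lemma LO_comm (a b : ℤ) (h : a + b ≠ 0) (p : BRing) : LO a (LO b p) = - LO b (LO a p) := by
  have := clifford (fun _ => 0) a b p
  rw [sZ_zero_seq, if_neg h] at this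
  simp only [mul_zero, map_zero, zero_mul] at this
  exact eq_neg_of_add_eq_zero_left this

lemma LO_sq (a : ℤ) (h : a ≠ 0) (p : BRing) : LO a (LO a p) = 0 :=
  self_eq_neg.1 (LO_comm a a (by omega) p)

lemma QP_LO (τ : BRing) (hQ : QP τ) (N : ℕ) (hN : 1 ≤ N) : QP (LO (-(N : ℤ)) τ) := by
  obtain ⟨M0, hM0⟩ := hQ
  refine ⟨M0, fun M hM f => ?_⟩
  have := congrArg (LO (-(N : ℤ))) (hM0 M hM (f.comp (LO (-(N : ℤ)))))
  rw [map_sum, map_smul] at this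
  rw [← LinearMap.comp_apply f, ← this]
  refine Finset.sum_congr rfl fun m _ => ?_
  rw [map_smul, LinearMap.comp_apply]
  by_cases h1 : m = N
  · subst h1
    rw [LO_sq _ (by omega)]; simp
  by_cases h2 : m = -N
  · subst h2
    rw [LO_sq _ (by omega)]; simp
  rw [LO_comm (-N) (-m) (by omega), LO_comm (-N) m (by omega), map_neg]
  simp

lemma step (τ : BRing) (hQ : QP τ) (N : ℕ) (hN : 1 ≤ N)
    (hv : ∀ j : ℕ, N < j → LO (-(j : ℤ)) τ = 0) (hσ : LO (-(N : ℤ)) τ ≠ 0) :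
    ∃ c, ∃ r : ℂ, r ≠ 0 ∧ VO N c (LO (-(N : ℤ)) τ) = r • τ := by
  set σ := LO (-(N : ℤ)) τ with hσd
  have hσσ : LO (-(N : ℤ)) σ = 0 := LO_sq _ (by omega) _
  have hmem : σ ∉ Submodule.span ℂ {τ} := by
    intro hm
    obtain ⟨r, hr⟩ := Submodule.mem_span_singleton.1 hm
    have h1 := congrArg (LO (-(N : ℤ))) hr
    rw [map_smul, hσσ, ← hσd] at h1
    rcases smul_eq_zero.1 h1 with h | h
    · rw [h, zero_smul] at hr; exact hσ hr.symm
    · exact hσ h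
  obtain ⟨f', hf1, hf2⟩ := Submodule.exists_le_ker_of_notMem hmem
  have hf3 : f' τ = 0 := hf2 (Submodule.mem_span_singleton_self τ)
  let f := (f' σ)⁻¹ • f'
  have hfσ : f σ = 1 := by simp [f, hf1]
  have hfτ : f τ = 0 := by simp [f, hf3]
  obtain ⟨c, hc⟩ := exists_sN_eq (fun n => (-1) ^ n * f (LO (n - N) τ)) (by
    simp only [pow_zero, one_mul, Nat.cast_zero, zero_sub]; exact hfσ)
  obtain ⟨M0, hM0⟩ := hQ
  set M := M0 + (shA τ).natDegree + N with hM
  have hz : VO N c τ = 0 := by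
    rw [VO_eq_LO _ _ _ (M + N + 1) (by omega)]
    have h1 := hM0 M (by omega) f
    rw [hfτ, zero_smul] at h1
    have h2 : ∑ m ∈ Finset.Icc (-(M : ℤ)) N, ((-1 : ℂ) ^ m * f (LO (-m) τ)) • LO m τ = 0 := by
      rw [← h1]
      refine Finset.sum_subset (Finset.Icc_subset_Icc_right (by omega)) fun m hm hm' => ?_
      rw [Finset.mem_Icc] at hm hm'
      have := hv m.toNat (by omega)
      rw [show ((m.toNat : ℕ) : ℤ) = m by omega] at this
      rw [this]; simp
    have h3 : ∑ n ∈ Finset.range (M + N + 1), sN n c • LO ((N : ℤ) - n) τ =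
        (-1 : ℂ) ^ N • ∑ m ∈ Finset.Icc (-(M : ℤ)) N, ((-1 : ℂ) ^ m * f (LO (-m) τ)) • LO m τ := by
      rw [Finset.smul_sum]
      refine Finset.sum_nbij' (fun n => (N : ℤ) - n) (fun m => ((N : ℤ) - m).toNat) ?_ ?_ ?_ ?_ ?_
      · intro n hn; rw [Finset.mem_range] at hn; rw [Finset.mem_Icc]; omega
      · intro m hm; rw [Finset.mem_Icc] at hm; rw [Finset.mem_range]; omega
      · intro n hn; simp
      · intro m hm; rw [Finset.mem_Icc] at hm; omega
      · intro n hn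
        rw [hc, smul_smul, neg_sub]
        congr 1
        rw [← mul_assoc]
        congr 1
        rw [zpow_sub₀ (by norm_num), zpow_natCast, zpow_natCast, mul_div_assoc', ← pow_add, ← two_mul,
          pow_mul]
        simp only [even_two, Even.neg_pow, one_pow, one_div, ← inv_pow]
        norm_num
    rw [h3, h2, smul_zero]
  refine ⟨c, 2 * (-1) ^ (-(N : ℤ)), ?_, ?_⟩
  · exact mul_ne_zero two_ne_zero (zpow_ne_zero _ (by norm_num))
  · have := clifford c (-(N : ℤ)) N τ
    rw [hz, map_zero, zero_add, neg_add_cancel] at this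
    rw [this, smul_eq_C_mul]
    have e : sZ 0 c = 1 := by
      have := sZ_of_nonneg 0 c
      rw [sN_zero] at this
      exact_mod_cast this
    rw [e, mul_one]

/-- Iterated vertex operators on the vacuum. -/
def PV : (m : ℕ) → (Fin m → ℕ × (ℕ → ℂ)) → BRing
  | 0, _ => 1
  | m + 1, f => VO ((f 0).1 : ℤ) (f 0).2 (PV m fun i => f i.succ)

lemma classify (N : ℕ) : ∀ τ : BRing, τ ≠ 0 → QP τ → (∀ n : ℕ, N < n → LO (-(n : ℤ)) τ = 0) →
    ∀ ε < 2, ∃ (k : ℕ) (f : Fin k → ℕ × (ℕ → ℂ)) (a : ℂ), k % 2 = ε ∧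
      StrictAnti (fun i => (f i).1) ∧ (∀ i, (f i).1 ≤ N) ∧ a ≠ 0 ∧ τ = a • PV k f := by
  induction N with
  | zero =>
    intro τ hτ _ hv ε hε
    have hC := vac_const τ (fun n hn => hv n (by omega))
    have ha : coeff 0 τ ≠ 0 := by
      intro h; rw [h, C_0] at hC; exact hτ hC
    have h1 : τ = coeff 0 τ • (1 : BRing) := by rw [smul_eq_C_mul, mul_one]; exact hC
    rcases (by omega : ε = 0 ∨ ε = 1) with rfl | rfl
    · exact ⟨0, Fin.elim0, coeff 0 τ, rfl, fun i => i.elim0, fun i => i.elim0, ha, h1⟩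
    · refine ⟨1, fun _ => (0, fun _ => 0), coeff 0 τ, rfl, fun i j h => ?_, fun i => le_rfl, ha, ?_⟩
      · exfalso; exact absurd h (by omega)
      · have : PV 1 (fun _ => (0, fun _ => 0)) = 1 := by
          have e := sZ_of_nonneg 0 (tShift fun _ => 0)
          rw [sN_zero] at e
          simp only [PV, VO_one]
          exact e
        rw [this]; exact h1
  | succ N ih =>
    intro τ hτ hQ hv ε hε
    by_cases hσ : LO (-((N + 1 : ℕ) : ℤ)) τ = 0
    · obtain ⟨k, f, a, h1, h2, h3, h4, h5⟩ := ih τ hτ hQ (fun n hn => by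
        rcases (by omega : n = N + 1 ∨ N + 1 < n) with rfl | h
        · exact hσ
        · exact hv n h) ε hε
      exact ⟨k, f, a, h1, h2, fun i => (h3 i).trans (by omega), h4, h5⟩
    · obtain ⟨c, r, hr, hc⟩ := step τ hQ (N + 1) (by omega) hv hσ
      obtain ⟨k, f, a, h1, h2, h3, h4, h5⟩ := ih _ hσ (QP_LO τ hQ (N + 1) (by omega))
        (fun n hn => by
          rcases (by omega : n = N + 1 ∨ N + 1 < n) with rfl | h
          · exact LO_sq _ (by omega) _
          · rw [LO_comm _ _ (by omega), hv n h, map_zero, neg_zero]) (1 - ε) (by omega)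
      refine ⟨k + 1, Fin.cons (N + 1, c) f, r⁻¹ * a, by omega, ?_, ?_, mul_ne_zero (inv_ne_zero hr) h4, ?_⟩
      · intro i j hij
        induction j using Fin.cases with
        | zero => exact absurd hij (by simp)
        | succ j =>
          induction i using Fin.cases with
          | zero => simp only [Fin.cons_succ, Fin.cons_zero]; have := h3 j; omega
          | succ i => simp only [Fin.cons_succ]; exact h2 (Fin.succ_lt_succ_iff.1 hij)
      · intro i
        induction i using Fin.cases with
        | zero => simp
        | succ i => simp only [Fin.cons_succ]; exact (h3 i).trans (by omega)
      · simp only [PV, Fin.cons_zero, Fin.cons_succ]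
        rw [h5, map_smul] at hc
        rw [← smul_smul, hc, smul_smul, inv_mul_cancel₀ hr, one_smul]

lemma exists_PV (τ : BRing) (hτ : τ ≠ 0) (h : SatisfiesBKP τ) :
    ∃ (n : ℕ) (f : Fin (2 * n) → ℕ × (ℕ → ℂ)) (a : ℂ),
      StrictAnti (fun i => (f i).1) ∧ a ≠ 0 ∧ τ = a • PV (2 * n) f := by
  obtain ⟨k, f, a, h1, h2, _, h4, h5⟩ := classify (shA τ).natDegree τ hτ (QP_of_BKP τ h)
    (fun n hn => LO_neg_eq_zero _ _ _ (by omega)) 0 (by omega)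
  obtain ⟨n, rfl⟩ : ∃ n, k = 2 * n := ⟨k / 2, by omega⟩
  exact ⟨n, f, a, h2, h4, h5⟩

end DKPHelpers

noncomputable section DKPHelpers
open MvPolynomial

/-- Translation. -/
def TT (x : ℕ → ℂ) : BRing →ₐ[ℂ] BRing := MvPolynomial.aeval fun i => X i + C (x i)

/-- Spread out a sequence over odd indices. -/
def xt (x : ℕ → ℂ) : ℕ → ℂ := fun j => if j % 2 = 1 then x ((j - 1) / 2) else 0

lemma TT_C (x : ℕ → ℂ) (a : ℂ) : TT x (C a) = C a := by
  unfold TT; rw [aeval_C]; rfl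

lemma TT_tShift (x c : ℕ → ℂ) (j : ℕ) : TT x (tShift c j) = tShift (fun j => c j + xt x j) j := by
  unfold tShift tTilde xt
  rw [map_add, TT_C]
  by_cases h : j % 2 = 1
  · simp only [h, if_true, C_add]
    simp [TT]; ring
  · simp [h]

lemma TT_shA (x : ℕ → ℂ) (p : BRing) :
    shA (TT x p) = Polynomial.map (TT x : BRing →+* BRing) (shA p) := by
  have : shA.comp (TT x) = (Polynomial.mapAlgHom (TT x)).comp shA := by
    apply MvPolynomial.algHom_ext
    intro i
    simp only [AlgHom.comp_apply, shA_X, Polynomial.coe_mapAlgHom]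
    simp only [Polynomial.map_sub, Polynomial.map_mul, Polynomial.map_pow, Polynomial.map_X,
      Polynomial.map_C, RingHom.coe_coe, TT_C]
    have e : TT x (X i) = X i + C (x i) := by simp [TT]
    rw [e, map_add, shA_X, shA_C, map_add]
    ring
  exact DFunLike.congr_fun this p

lemma TT_VO (x : ℕ → ℂ) (b : ℤ) (c : ℕ → ℂ) (p : BRing) :
    TT x (VO b c p) = VO b (fun j => c j + xt x j) (TT x p) := by
  rw [VO_eq b c p _ (Nat.lt_succ_self _), VO_eq _ _ (TT x p) ((shA p).natDegree + 1) (by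
    rw [TT_shA]; exact Nat.lt_succ_of_le Polynomial.natDegree_map_le), map_sum]
  refine Finset.sum_congr rfl fun k _ => ?_
  rw [map_mul, sZ_map, TT_shA, Polynomial.coeff_map]
  simp only [TT_tShift]
  rfl

lemma e0_TT (x : ℕ → ℂ) (p : BRing) : e0 (TT x p) = eval x p := by
  have : e0.comp (TT x) = MvPolynomial.aeval x := by
    apply MvPolynomial.algHom_ext
    intro i
    simp [e0, TT]
  have := DFunLike.congr_fun this p
  rw [← coe_aeval_eq_eval]
  exact this

/-- Shift the sequences of a family. -/
def fsh {m : ℕ} (x : ℕ → ℂ) (f : Fin m → ℕ × (ℕ → ℂ)) : Fin m → ℕ × (ℕ → ℂ) :=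
  fun i => ((f i).1, fun j => (f i).2 j + xt x j)

lemma TT_PV (x : ℕ → ℂ) (m : ℕ) (f : Fin m → ℕ × (ℕ → ℂ)) : TT x (PV m f) = PV m (fsh x f) := by
  induction m with
  | zero => simp [PV]
  | succ m ih =>
    simp only [PV]
    rw [TT_VO, ih]
    rfl

/-- Contraction coefficient. -/
def kap (k : ℕ) (u : ℕ × (ℕ → ℂ)) : ℂ := 2 * (-1) ^ k * sZ ((u.1 : ℤ) - k) u.2

lemma clifford' (k : ℕ) (u : ℕ × (ℕ → ℂ)) (p : BRing) :
    LO (-(k : ℤ)) (VO (u.1 : ℤ) u.2 p) = kap k u • p - VO (u.1 : ℤ) u.2 (LO (-(k : ℤ)) p) := by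
  have := clifford u.2 (-(k : ℤ)) u.1 p
  rw [eq_sub_iff_add_eq, this, smul_eq_C_mul]
  unfold kap
  rw [zpow_neg, zpow_natCast, ← inv_pow, show (-(k : ℤ) + u.1) = u.1 - k by ring]
  norm_num

lemma LO_one (k : ℕ) : LO (-(k : ℤ)) 1 = if k = 0 then 1 else 0 := by
  rw [VO_one]
  split_ifs with h
  · subst h
    have := sZ_of_nonneg 0 (tShift fun _ => 0)
    rw [sN_zero] at this
    simpa using this
  · exact sZ_of_neg (by omega) _

lemma LO_PV (k m : ℕ) (f : Fin (m + 1) → ℕ × (ℕ → ℂ)) :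
    LO (-(k : ℤ)) (PV (m + 1) f) =
      ∑ j : Fin (m + 1), ((-1) ^ (j : ℕ) * kap k (f j)) • PV m (fun i => f (j.succAbove i)) +
        ((-1) ^ (m + 1) * (if k = 0 then 1 else 0 : ℂ)) • PV (m + 1) f := by
  induction m with
  | zero =>
    have e : PV 1 f = VO ((f 0).1 : ℤ) (f 0).2 1 := rfl
    have e' : ∀ g, PV 0 g = 1 := fun _ => rfl
    rw [e, clifford', LO_one]
    simp only [Finset.univ_unique, Finset.sum_singleton, e']
    split_ifs <;> simp [sub_eq_add_neg]
  | succ m ih =>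
    have e : PV (m + 2) f = VO ((f 0).1 : ℤ) (f 0).2 (PV (m + 1) fun i => f i.succ) := rfl
    rw [e, clifford', ih, Fin.sum_univ_succ (n := m + 1), map_add, map_sum, map_smul]
    simp only [map_smul]
    have e2 : ∀ j : Fin (m + 1), PV (m + 1) (fun i => f (j.succ.succAbove i)) =
        VO ((f 0).1 : ℤ) (f 0).2 (PV m fun i => f (j.succAbove i).succ) := by
      intro j
      simp only [PV, Fin.succ_succAbove_zero, Fin.succ_succAbove_succ]
    simp only [e2, Fin.val_succ, pow_succ, Fin.val_zero, pow_zero, one_mul, Fin.succAbove_zero, mul_neg, mul_one, neg_mul, neg_smul, neg_neg,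
      Finset.sum_neg_distrib]
    abel

lemma e0_LO (k : ℕ) (p : BRing) : e0 (LO (-(k : ℤ)) p) = e0 ((shA p).coeff k) := by
  rw [e0_VO _ _ _ ((shA p).natDegree + k + 1) (by omega)]
  simp only [sZ_zero_seq]
  rw [Finset.sum_eq_single_of_mem k (by simp)]
  · simp
  · intro b _ hb
    rw [if_neg (by omega), zero_mul]

lemma e0_VO' (b : ℤ) (c : ℕ → ℂ) (p : BRing) (K : ℕ) (hK : (shA p).natDegree < K) :
    e0 (VO b c p) = ∑ k ∈ Finset.range K, sZ (b + k) c * e0 (LO (-(k : ℤ)) p) := by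
  simp only [e0_LO]
  exact e0_VO b c p K hK

/-- Numerical two-point function. -/
def rhoN (u v : ℕ × (ℕ → ℂ)) : ℂ := (2 : ℂ)⁻¹ * (sN u.1 u.2 * sN v.1 v.2) +
    ∑ ℓ ∈ Finset.Icc 1 v.1, ((-1 : ℂ) ^ ℓ) * (sN (u.1 + ℓ) u.2 * sN (v.1 - ℓ) v.2)

/-- Corrected contraction coefficient. -/
def kap' (k : ℕ) (u : ℕ × (ℕ → ℂ)) : ℂ := if k = 0 then sN u.1 u.2 else kap k u

lemma sum_kap' (u v : ℕ × (ℕ → ℂ)) (K : ℕ) (hK : v.1 < K) :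
    ∑ k ∈ Finset.range K, sZ ((u.1 : ℤ) + k) u.2 * kap' k v = 2 * rhoN u v := by
  have h1 : ∑ k ∈ Finset.range K, sZ ((u.1 : ℤ) + k) u.2 * kap' k v =
      ∑ k ∈ Finset.range (v.1 + 1), sZ ((u.1 : ℤ) + k) u.2 * kap' k v := by
    symm
    refine Finset.sum_subset (Finset.range_subset_range.2 (by omega)) fun k hk hk' => ?_
    rw [Finset.mem_range] at hk hk'
    unfold kap' kap
    rw [if_neg (by omega), sZ_of_neg (m := (v.1 : ℤ) - k) (by omega)]; ring
  rw [h1, Finset.sum_range_succ']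
  unfold rhoN
  rw [mul_add, add_comm]
  congr 1
  · simp only [kap', if_true, Nat.cast_zero, add_zero, sZ_of_nonneg]; ring
  · rw [Finset.mul_sum, Finset.range_eq_Ico,
      Finset.sum_Ico_add' (fun k : ℕ => sZ ((u.1 : ℤ) + k) u.2 * kap' k v)]
    refine Finset.sum_congr (by ext; simp) fun k hk => ?_
    rw [Finset.mem_Icc] at hk
    unfold kap' kap
    rw [if_neg (by omega), show (u.1 : ℤ) + k = (u.1 + k : ℕ) by push_cast; ring,
      show (v.1 : ℤ) - k = (v.1 - k : ℕ) by omega, sZ_of_nonneg, sZ_of_nonneg]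
    ring

lemma e0_LO_PV (k m : ℕ) (hm : Even m) (f : Fin (m + 1) → ℕ × (ℕ → ℂ)) :
    e0 (LO (-(k : ℤ)) (PV (m + 1) f)) =
      ∑ j : Fin (m + 1), ((-1) ^ (j : ℕ) * kap' k (f j)) * e0 (PV m (fun i => f (j.succAbove i))) := by
  have hs : (-1 : ℂ) ^ (m + 1) = -1 := hm.add_one.neg_one_pow
  have h1 := congrArg e0 (LO_PV k m f)
  rw [map_add, map_sum, hs] at h1
  simp only [map_smul, smul_eq_mul] at h1
  by_cases hk : k = 0
  · subst hk
    rw [e0_LO, shA_coeff_zero] at h1 ⊢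
    simp only [kap', if_true]
    have e : ∀ j, kap 0 (f j) = 2 * sN (f j).1 (f j).2 := by
      intro j; simp [kap, sZ_of_nonneg]
    simp only [e, if_true] at h1
    have h2 : ∑ j : Fin (m + 1), ((-1) ^ (j : ℕ) * (2 * sN (f j).1 (f j).2)) *
        e0 (PV m (fun i => f (j.succAbove i))) = 2 * ∑ j : Fin (m + 1), ((-1) ^ (j : ℕ) *
          sN (f j).1 (f j).2) * e0 (PV m (fun i => f (j.succAbove i))) := by
      rw [Finset.mul_sum]
      exact Finset.sum_congr rfl fun j _ => by ring
    rw [h2] at h1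
    linear_combination h1 / 2
  · rw [h1]
    simp only [kap', hk, if_false, mul_zero, zero_mul, add_zero]

lemma wick (m : ℕ) (hm : Even m) (f : Fin (m + 2) → ℕ × (ℕ → ℂ)) :
    e0 (PV (m + 2) f) = ∑ j : Fin (m + 1), ((-1) ^ (j : ℕ) * (2 * rhoN (f 0) (f j.succ))) *
      e0 (PV m (fun i => f (j.succAbove i).succ)) := by
  have e : PV (m + 2) f = VO ((f 0).1 : ℤ) (f 0).2 (PV (m + 1) fun i => f i.succ) := rfl
  set K := (shA (PV (m + 1) fun i => f i.succ)).natDegree + ∑ j : Fin (m + 1), (f j.succ).1 + 1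
  have hK : ∀ j : Fin (m + 1), (f j.succ).1 < K := by
    intro j
    have := Finset.single_le_sum (f := fun j : Fin (m + 1) => (f j.succ).1)
      (fun _ _ => Nat.zero_le _) (Finset.mem_univ j)
    omega
  rw [e, e0_VO' _ _ _ K (by omega)]
  simp only [e0_LO_PV _ m hm, Finset.mul_sum]
  rw [Finset.sum_comm]
  refine Finset.sum_congr rfl fun j _ => ?_
  rw [← sum_kap' _ _ K (hK j), Finset.mul_sum, Finset.sum_mul]
  exact Finset.sum_congr rfl fun k _ => by ring

end DKPHelpers

noncomputable section DKPHelpers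
open MvPolynomial

lemma ndiv (n : ℕ) : 2 * n / 2 = n := by omega

/-- Reindexed Pfaffian condition. -/
def pfC (r : ℕ) (σ : Equiv.Perm (Fin (2 * r))) : Prop :=
  (∀ i : Fin r,
      σ ⟨2 * i.val, by have := i.isLt; omega⟩ < σ ⟨2 * i.val + 1, by have := i.isLt; omega⟩) ∧
  (∀ i j : Fin r, i < j →
      σ ⟨2 * i.val, by have := i.isLt; omega⟩ < σ ⟨2 * j.val, by have := j.isLt; omega⟩)

open scoped Classical in
/-- Reindexed Pfaffian. -/
def pfR {R : Type*} [CommRing R] (r : ℕ) (A : Matrix (Fin (2 * r)) (Fin (2 * r)) R) : R :=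
  ∑ σ : Equiv.Perm (Fin (2 * r)),
    if pfC r σ then
      (Equiv.Perm.sign σ : ℤ) •
        ∏ i : Fin r,
          A (σ ⟨2 * i.val, by have := i.isLt; omega⟩)
            (σ ⟨2 * i.val + 1, by have := i.isLt; omega⟩)
    else 0

lemma pfaffian_eq_pfR {R : Type*} [CommRing R] (r : ℕ) (A : Matrix (Fin (2 * r)) (Fin (2 * r)) R) :
    pfaffian A = pfR r A := by
  classical
  unfold pfaffian pfR
  refine Finset.sum_congr rfl fun σ _ => ?_
  have h : pfaffianCond σ ↔ pfC r σ := by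
    unfold pfaffianCond pfC
    refine and_congr ?_ ?_
    · exact ⟨fun h i => h (Fin.cast (ndiv r).symm i), fun h i => h (Fin.cast (ndiv r) i)⟩
    · exact ⟨fun h i j hij => h (Fin.cast (ndiv r).symm i) (Fin.cast (ndiv r).symm j) hij,
        fun h i j hij => h (Fin.cast (ndiv r) i) (Fin.cast (ndiv r) j) hij⟩
  refine if_congr h ?_ rfl
  congr 1
  exact Fintype.prod_equiv (finCongr (ndiv r)) _ _ fun i => rfl

/-- Permutation built from a partner of `0` and a permutation of the rest. -/
def Eperm {m : ℕ} (q : Fin (m + 1) × Equiv.Perm (Fin m)) : Equiv.Perm (Fin (m + 2)) :=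
  Equiv.Perm.decomposeFin.symm (0, q.1.cycleRange.symm * Equiv.Perm.decomposeFin.symm (0, q.2))

lemma Eperm_zero {m : ℕ} (q : Fin (m + 1) × Equiv.Perm (Fin m)) : Eperm q 0 = 0 := by
  simp [Eperm]

lemma Eperm_one {m : ℕ} (q : Fin (m + 1) × Equiv.Perm (Fin m)) :
    Eperm q (Fin.succ 0) = q.1.succ := by
  rw [Eperm, Equiv.Perm.decomposeFin_symm_apply_succ]
  simp

lemma Eperm_succ {m : ℕ} (q : Fin (m + 1) × Equiv.Perm (Fin m)) (i : Fin m) :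
    Eperm q i.succ.succ = (q.1.succAbove (q.2 i)).succ := by
  rw [Eperm, Equiv.Perm.decomposeFin_symm_apply_succ, Equiv.Perm.mul_apply,
    Equiv.Perm.decomposeFin_symm_apply_succ]
  simp

lemma Eperm_sign {m : ℕ} (q : Fin (m + 1) × Equiv.Perm (Fin m)) :
    Equiv.Perm.sign (Eperm q) = (-1) ^ (q.1 : ℕ) * Equiv.Perm.sign q.2 := by
  rw [Eperm, Equiv.Perm.decomposeFin.symm_sign, Equiv.Perm.sign_mul, Equiv.Perm.sign_symm,
    Fin.sign_cycleRange, Equiv.Perm.decomposeFin.symm_sign]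
  simp

lemma Eperm_inj {m : ℕ} : Function.Injective (Eperm (m := m)) := by
  rintro ⟨j, π⟩ ⟨j', π'⟩ h
  have h1 : j = j' := by
    have := congrArg (fun s => s (Fin.succ 0)) h
    simp only [Eperm_one] at this
    exact Fin.succ_injective _ this
  subst h1
  congr 1
  ext i
  have := congrArg (fun s => s i.succ.succ) h
  simp only [Eperm_succ] at this
  rw [Fin.succAbove_right_injective (Fin.succ_injective _ this)]

lemma perm_eq_decompose {m : ℕ} (σ : Equiv.Perm (Fin (m + 1))) (h : σ 0 = 0) :
    ∃ ρ, σ = Equiv.Perm.decomposeFin.symm (0, ρ) := by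
  refine ⟨(Equiv.Perm.decomposeFin σ).2, ?_⟩
  have h1 : (Equiv.Perm.decomposeFin σ).1 = 0 := by
    have := Equiv.Perm.decomposeFin_symm_apply_zero (Equiv.Perm.decomposeFin σ).1
      (Equiv.Perm.decomposeFin σ).2
    rw [Prod.mk.eta, Equiv.symm_apply_apply, h] at this
    exact this.symm
  rw [← h1, Prod.mk.eta, Equiv.symm_apply_apply]

lemma Eperm_surj {m : ℕ} (σ : Equiv.Perm (Fin (m + 2))) (h : σ 0 = 0) : ∃ q, Eperm q = σ := by
  obtain ⟨ρ, rfl⟩ := perm_eq_decompose σ h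
  obtain ⟨π, hπ⟩ := perm_eq_decompose ((ρ 0).cycleRange * ρ) (by simp)
  refine ⟨(ρ 0, π), ?_⟩
  unfold Eperm
  simp only
  rw [← hπ]
  congr 2
  ext i
  simp

lemma pfC_zero (r : ℕ) (σ : Equiv.Perm (Fin (2 * r + 2))) (h : pfC (r + 1) σ) : σ 0 = 0 := by
  obtain ⟨h1, h2⟩ := h
  have h3 : ∀ i : Fin (r + 1), σ 0 ≤ σ ⟨2 * i.val, by have := i.isLt; omega⟩ := by
    intro i
    induction i using Fin.cases with
    | zero => exact le_rfl
    | succ i => exact (h2 0 i.succ (Fin.succ_pos i)).le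
  have h4 : ∀ y, σ 0 ≤ σ y := by
    intro y
    have hy := y.isLt
    rcases Nat.even_or_odd' y.val with ⟨k, hk | hk⟩
    · have := h3 ⟨k, by omega⟩
      rw [show y = ⟨2 * k, by omega⟩ from Fin.ext hk]
      exact this
    · have := (h3 ⟨k, by omega⟩).trans (h1 ⟨k, by omega⟩).le
      rw [show y = ⟨2 * k + 1, by omega⟩ from Fin.ext hk]
      exact this
  have := h4 (σ.symm 0)
  rw [Equiv.apply_symm_apply] at this
  exact le_antisymm this (Fin.zero_le _)

lemma pfC_Eperm (r : ℕ) (q : Fin (2 * r + 1) × Equiv.Perm (Fin (2 * r))) :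
    pfC (r + 1) (Eperm q) ↔ pfC r q.2 := by
  have hlt : ∀ a b : Fin (2 * r), Eperm q a.succ.succ < Eperm q b.succ.succ ↔ q.2 a < q.2 b := by
    intro a b
    rw [Eperm_succ, Eperm_succ, Fin.succ_lt_succ_iff,
      (Fin.strictMono_succAbove q.1).lt_iff_lt]
  constructor
  · rintro ⟨h1, h2⟩
    exact ⟨fun i => (hlt _ _).1 (h1 i.succ), fun i j hij => (hlt _ _).1
      (h2 i.succ j.succ (Fin.succ_lt_succ_iff.2 hij))⟩
  · rintro ⟨h1, h2⟩
    refine ⟨fun i => ?_, fun i j hij => ?_⟩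
    · induction i using Fin.cases with
      | zero =>
        have : Eperm q 0 < Eperm q (Fin.succ 0) := by
          rw [Eperm_zero, Eperm_one]; exact Fin.succ_pos _
        exact this
      | succ i => exact (hlt _ _).2 (h1 i)
    · induction j using Fin.cases with
      | zero => exact absurd hij (by simp)
      | succ j =>
        induction i using Fin.cases with
        | zero =>
          have : Eperm q 0 < Eperm q (Fin.succ (Fin.succ ⟨2 * j.val, by have := j.isLt; omega⟩)) := by
            rw [Eperm_zero, Eperm_succ]; exact Fin.succ_pos _
          exact this
        | succ i =>
          have := (hlt ⟨2 * i.val, by have := i.isLt; omega⟩ ⟨2 * j.val, by have := j.isLt; omega⟩).2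
            (h2 i j (Fin.succ_lt_succ_iff.1 hij))
          exact this

lemma pfR_succ {R : Type*} [CommRing R] (r : ℕ) (A : Matrix (Fin (2 * r + 2)) (Fin (2 * r + 2)) R) :
    pfR (r + 1) A = ∑ j : Fin (2 * r + 1), (-1) ^ (j : ℕ) * A 0 j.succ *
      pfR r (A.submatrix (fun i => (j.succAbove i).succ) (fun i => (j.succAbove i).succ)) := by
  classical
  symm
  unfold pfR
  simp only [Finset.mul_sum]
  rw [← Finset.sum_product', Finset.univ_product_univ]
  refine Finset.sum_of_injOn Eperm (Eperm_inj.injOn) (fun _ _ => Finset.mem_coe.2 (Finset.mem_univ _)) ?_ ?_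
  · intro σ _ hσ
    rw [if_neg]
    intro hc
    obtain ⟨q, hq⟩ := Eperm_surj σ (pfC_zero r σ hc)
    exact hσ ⟨q, by simp, hq⟩
  · intro q _
    by_cases hq : pfC r q.2
    · rw [if_pos hq, if_pos ((pfC_Eperm r q).2 hq), Eperm_sign, Fin.prod_univ_succ]
      have e0 : A (Eperm q ⟨2 * (0 : Fin (r + 1)).val, by simp⟩)
          (Eperm q ⟨2 * (0 : Fin (r + 1)).val + 1, by simp⟩) = A 0 q.1.succ := by
        have : A (Eperm q 0) (Eperm q (Fin.succ 0)) = A 0 q.1.succ := by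
          rw [Eperm_zero, Eperm_one]
        exact this
      have e1 : ∀ i : Fin r, A (Eperm q ⟨2 * i.succ.val, by have := i.isLt; rw [Fin.val_succ]; omega⟩)
          (Eperm q ⟨2 * i.succ.val + 1, by have := i.isLt; rw [Fin.val_succ]; omega⟩) =
          (A.submatrix (fun i => (q.1.succAbove i).succ) (fun i => (q.1.succAbove i).succ))
            (q.2 ⟨2 * i.val, by have := i.isLt; omega⟩)
            (q.2 ⟨2 * i.val + 1, by have := i.isLt; omega⟩) := by
        intro i
        rw [Matrix.submatrix_apply, ← Eperm_succ, ← Eperm_succ]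
        rfl
      simp only [e1]
      rw [e0]
      simp only [zsmul_eq_mul]
      push_cast
      ring
    · rw [if_neg hq, if_neg (fun h => hq ((pfC_Eperm r q).1 h)), mul_zero]

lemma pfR_map {R S : Type*} [CommRing R] [CommRing S] (g : R →+* S) (r : ℕ)
    (A : Matrix (Fin (2 * r)) (Fin (2 * r)) R) :
    g (pfR r A) = pfR r (A.map g) := by
  unfold pfR
  rw [map_sum]
  refine Finset.sum_congr rfl fun σ _ => ?_
  split_ifs
  · rw [map_zsmul, map_prod]; rfl
  · exact map_zero g

end DKPHelpers

noncomputable section DKPHelpers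
open MvPolynomial

lemma e0_PV_eq (n : ℕ) (f : Fin (2 * n) → ℕ × (ℕ → ℂ)) :
    e0 (PV (2 * n) f) = 2 ^ n * pfR n (skewOf fun i j => rhoN (f i) (f j)) := by
  induction n with
  | zero =>
    have h1 : e0 (PV (2 * 0) f) = 1 := map_one e0
    rw [h1]
    unfold pfR
    rw [Finset.sum_eq_single (1 : Equiv.Perm (Fin (2 * 0))),
      if_pos ⟨fun i => i.elim0, fun i => i.elim0⟩]
    · simp
    · intro b _ hb
      exact absurd (Equiv.ext fun i => absurd i.isLt (by omega)) hb
    · intro hb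
      exact absurd (Finset.mem_univ _) hb
  | succ n ih =>
    have h1 := wick (2 * n) (even_two_mul n) f
    have h2 := pfR_succ n (skewOf fun i j : Fin (2 * n + 2) => rhoN (f i) (f j))
    refine h1.trans ?_
    refine Eq.trans ?_ (congrArg (fun z => 2 ^ (n + 1) * z) h2).symm
    simp only [Finset.mul_sum]
    refine Finset.sum_congr rfl fun j _ => ?_
    rw [ih]
    have e1 : (skewOf fun i j : Fin (2 * n + 2) => rhoN (f i) (f j)) 0 j.succ =
        rhoN (f 0) (f j.succ) := by
      simp [skewOf]
    have e2 : (skewOf fun i j : Fin (2 * n + 2) => rhoN (f i) (f j)).submatrix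
        (fun i => (j.succAbove i).succ) (fun i => (j.succAbove i).succ) =
        skewOf fun i i' : Fin (2 * n) => rhoN (f (j.succAbove i).succ) (f (j.succAbove i').succ) := by
      ext a b
      simp only [skewOf, Matrix.submatrix_apply, Matrix.of_apply, Fin.succ_lt_succ_iff,
        (Fin.strictMono_succAbove j).lt_iff_lt]
    rw [e1, e2]
    ring

lemma eval_tShift (x c : ℕ → ℂ) (j : ℕ) : eval x (tShift c j) = c j + xt x j := by
  rw [← e0_TT, TT_tShift, e0_tShift]

lemma eval_sB (x c : ℕ → ℂ) (n : ℕ) : eval x (sB n (tShift c)) = sN n (fun j => c j + xt x j) := by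
  have h : eval x (sB n (tShift c)) = (MvPolynomial.aeval x : BRing →ₐ[ℂ] ℂ) (sN n (tShift c)) := by
    rw [← coe_aeval_eq_eval]; rfl
  rw [h, sN_map]
  congr 1
  funext j
  rw [← eval_tShift, ← coe_aeval_eq_eval]
  rfl

lemma sqrt2_inv_mul : sqrt2⁻¹ * sqrt2⁻¹ = 2⁻¹ := by
  rw [← mul_inv]
  congr 1
  unfold sqrt2
  rw [← Complex.ofReal_mul, Real.mul_self_sqrt (by norm_num)]
  norm_num

lemma eval_rhoB (x : ℕ → ℂ) (u v : ℕ × (ℕ → ℂ)) :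
    eval x (rhoB u.1 v.1 (tShift u.2) (tShift v.2) 0 0) =
      rhoN (u.1, fun j => u.2 j + xt x j) (v.1, fun j => v.2 j + xt x j) := by
  unfold rhoB rhoN
  simp only [map_add, map_mul, map_sub, map_sum, smul_eval, eval_sB, C_0, map_zero, sub_zero,
    add_zero]
  rw [← sqrt2_inv_mul]
  ring

lemma PV_eq (n : ℕ) (f : Fin (2 * n) → ℕ × (ℕ → ℂ)) :
    PV (2 * n) f = (2 : ℂ) ^ n • pfaffian (rhoMatrixEven (fun i => (f i).1) (fun i => (f i).2)
      (fun _ => 0)) := by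
  apply MvPolynomial.funext
  intro x
  rw [← e0_TT, TT_PV, e0_PV_eq, smul_eval, pfaffian_eq_pfR, pfR_map]
  congr 2
  ext i j
  simp only [skewOf, rhoMatrixEven, Matrix.map_apply, Matrix.of_apply]
  split_ifs
  · rw [eval_rhoB]; rfl
  · rw [map_neg, eval_rhoB]; rfl
  · rw [map_zero]

lemma final (τ : BRing) (hτ : τ ≠ 0) (h : SatisfiesBKP τ) :
    ∃ (n : ℕ) (lam : Fin (2 * n) → ℕ) (_ : StrictAnti lam)
      (c : Fin (2 * n) → ℕ → ℂ) (b : Fin (2 * n) → ℂ) (a : ℂ),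
      a ≠ 0 ∧ τ = a • pfaffian (rhoMatrixEven lam c b) := by
  obtain ⟨n, f, a, h1, h2, h3⟩ := exists_PV τ hτ h
  refine ⟨n, fun i => (f i).1, h1, fun i => (f i).2, fun _ => 0, a * 2 ^ n,
    mul_ne_zero h2 (pow_ne_zero _ two_ne_zero), ?_⟩
  rw [h3, PV_eq, smul_smul]

end DKPHelpers


noncomputable section

/-- Every nonzero polynomial tau-function of the DKP hierarchy in the even
sector `V₀`, i.e. every nonzero `τ ∈ ℂ[t₁,t₃,t₅,…]` satisfying the BKP bilinear identity,
is of the form `τ = a · Pf( ρ_{λ_i,λ_j}(t̃+c_i, t̃+c_j; b_i, b_j) )_{1≤i,j≤2n}` for some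
`n ≥ 0`, integers `λ_1 > ⋯ > λ_{2n} ≥ 0`, sequences `c_i`, constants `b_i ∈ ℂ`, and a
nonzero `a ∈ ℂ`. -/
theorem polynomial_tau_DKP_even_classification (τ : BRing) (hτ : τ ≠ 0)
    (h : SatisfiesBKP τ) :
    ∃ (n : ℕ) (lam : Fin (2 * n) → ℕ) (_ : StrictAnti lam)
      (c : Fin (2 * n) → ℕ → ℂ) (b : Fin (2 * n) → ℂ) (a : ℂ),
      a ≠ 0 ∧ τ = a • pfaffian (rhoMatrixEven lam c b) := by
  exact final τ hτ h

end
end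

section
/- Let n ≥ 0, let λ_1 > λ_2 > ⋯ > λ_{2n+1} ≥ 0 be integers, let c_1,…,c_{2n+1} be sequences of complex numbers and b_1,…,b_{2n+1} ∈ ℂ. Let A be the (2n+2)×(2n+2) skew-symmetric matrix with rows and columns indexed by 0,1,…,2n+1, with entries A_{0,j} = ρ_{λ_j}(t̃ + c_j; b_j) for 1 ≤ j ≤ 2n+1 and A_{i,j} = ρ_{λ_i,λ_j}(t̃ + c_i, t̃ + c_j; b_i, b_j) for 1 ≤ i < j ≤ 2n+1. Then the polynomial τ_1 = Pf(A) satisfies the BKP bilinear identity (which is the bosonic form of the DKP hierarchy on the odd sector V_1). -/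
noncomputable section
open MvPolynomial
namespace BKPProof

open PowerSeries in
/-- generating series -/
def gs {R : Type*} [CommRing R] [Algebra ℂ R] (c : ℕ → R) : PowerSeries R :=
  PowerSeries.mk fun n => MvPolynomial.aeval c (schurPoly n)

/-- derivative of the exponent -/
def dD {R : Type*} [CommRing R] [Algebra ℂ R] (c : ℕ → R) : PowerSeries R :=
  PowerSeries.mk fun j => ((j : R) + 1) * c (j + 1)

section
variable {R : Type*} [CommRing R] [Algebra ℂ R]

lemma coeff_gs (c : ℕ → R) (n : ℕ) :
    PowerSeries.coeff n (gs c) = MvPolynomial.aeval c (schurPoly n) := by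
  simp [gs]

lemma schur_zero (c : ℕ → R) : MvPolynomial.aeval c (schurPoly 0) = 1 := by
  rw [schurPoly]; simp

lemma isUnit_succ (n : ℕ) : IsUnit ((n : R) + 1) := by
  have h : IsUnit (algebraMap ℂ R ((n : ℂ) + 1)) :=
    IsUnit.map _ (isUnit_iff_ne_zero.mpr (Nat.cast_add_one_ne_zero n))
  simpa using h

lemma schur_rec (c : ℕ → R) (n : ℕ) :
    ((n : R) + 1) * MvPolynomial.aeval c (schurPoly (n + 1)) =
      ∑ j ∈ Finset.range (n + 1), (((j : R) + 1) * c (j + 1)) *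
        MvPolynomial.aeval c (schurPoly (n - j)) := by
  have h0 : ((n : ℂ) + 1) ≠ 0 := Nat.cast_add_one_ne_zero n
  have h : ((n : ℂ) + 1) • schurPoly (n + 1) = ∑ j ∈ Finset.range (n + 1),
          ((j + 1 : ℂ)) • (MvPolynomial.X (j + 1) * schurPoly (n - j)) := by
    rw [schurPoly, smul_smul, mul_inv_cancel₀ h0, one_smul]
  have h2 := congrArg (MvPolynomial.aeval c) h
  simp only [map_smul, map_sum, map_mul, MvPolynomial.aeval_X] at h2
  simp only [Algebra.smul_def, map_add, map_natCast, map_one] at h2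
  rw [h2]
  exact Finset.sum_congr rfl fun j _ => by ring

lemma gs_deriv (c : ℕ → R) : PowerSeries.derivative R (gs c) = dD c * gs c := by
  ext n
  rw [PowerSeries.coeff_derivative, PowerSeries.coeff_mul,
    Finset.Nat.sum_antidiagonal_eq_sum_range_succ_mk, coeff_gs, mul_comm, schur_rec]
  simp [dD, coeff_gs]

lemma gs_const (c : ℕ → R) : PowerSeries.coeff 0 (gs c) = 1 := by
  rw [coeff_gs, schur_zero]

lemma ode_unique (D F G : PowerSeries R) (hF : PowerSeries.derivative R F = D * F)
    (hG : PowerSeries.derivative R G = D * G)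
    (h0 : PowerSeries.coeff 0 F = PowerSeries.coeff 0 G) : F = G := by
  ext n
  induction n using Nat.strong_induction_on with
  | _ n ih =>
    cases n with
    | zero => exact h0
    | succ n =>
      have h1 := congrArg (PowerSeries.coeff n) hF
      have h2 := congrArg (PowerSeries.coeff n) hG
      rw [PowerSeries.coeff_derivative, PowerSeries.coeff_mul] at h1 h2
      have : PowerSeries.coeff (n + 1) F * ((n : R) + 1) =
          PowerSeries.coeff (n + 1) G * ((n : R) + 1) := by
        rw [h1, h2]
        refine Finset.sum_congr rfl fun p hp => ?_
        rw [ih p.2]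
        have := Finset.HasAntidiagonal.mem_antidiagonal.mp hp
        omega
      exact (isUnit_succ n).mul_right_cancel this

lemma gs_add (a b : ℕ → R) : gs (fun j => a j + b j) = gs a * gs b := by
  apply ode_unique (dD (fun j => a j + b j))
  · exact gs_deriv _
  · rw [Derivation.leibniz, gs_deriv, gs_deriv]
    have : dD (fun j => a j + b j) = dD a + dD b := by
      ext n; simp [dD]; ring
    rw [this]; simp only [smul_eq_mul]; ring
  · rw [gs_const, PowerSeries.coeff_mul]
    simp [-PowerSeries.coeff_zero_eq_constantCoeff, gs_const]

lemma gs_zero : gs (fun _ => (0 : R)) = 1 := by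
  apply ode_unique (dD (fun _ => 0))
  · exact gs_deriv _
  · have : dD (fun _ => (0 : R)) = 0 := by ext n; simp [dD]
    rw [this, zero_mul]; exact PowerSeries.derivative_one
  · rw [gs_const]; simp

lemma gs_neg (a : ℕ → R) : gs (fun j => - a j) * gs a = 1 := by
  rw [← gs_add, ← gs_zero]; congr 1; funext j; ring

lemma gs_map {S : Type*} [CommRing S] [Algebra ℂ S] (φ : R →ₐ[ℂ] S) (c : ℕ → R) :
    PowerSeries.map (φ : R →+* S) (gs c) = gs (fun j => φ (c j)) := by
  ext n
  rw [PowerSeries.coeff_map, coeff_gs, coeff_gs]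
  change φ _ = _
  rw [← MvPolynomial.comp_aeval_apply]

lemma gs_rescale (c : ℕ → R) :
    PowerSeries.rescale (-1 : R) (gs c) = gs (fun j => (-1) ^ j * c j) := by
  apply ode_unique (dD (fun j => (-1) ^ j * c j))
  · have h : PowerSeries.derivative R (PowerSeries.rescale (-1 : R) (gs c)) =
        - PowerSeries.rescale (-1 : R) (PowerSeries.derivative R (gs c)) := by
      ext n
      simp only [PowerSeries.coeff_derivative, PowerSeries.coeff_rescale, map_neg]
      ring
    have h2 : dD (fun j => (-1) ^ j * c j) = - PowerSeries.rescale (-1 : R) (dD c) := by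
      ext n; simp [dD, PowerSeries.coeff_rescale]; ring
    rw [h, gs_deriv, map_mul, h2, neg_mul]
  · exact gs_deriv _
  · rw [PowerSeries.coeff_rescale, gs_const, gs_const]; simp

/-- shift increments -/
lemma gs_shift (w : R) (d : ℕ → R)
    (hd : ∀ j : ℕ, ((j : R) + 1) * d (j + 1) = if j % 2 = 0 then 2 * w ^ (j + 1) else 0) :
    gs d * (1 - PowerSeries.C w * PowerSeries.X) = 1 + PowerSeries.C w * PowerSeries.X := by
  have hD : dD d * ((1 - PowerSeries.C w * PowerSeries.X) *
      (1 + PowerSeries.C w * PowerSeries.X)) = PowerSeries.C (2 * w) := by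
    have e : (1 - PowerSeries.C w * PowerSeries.X) *
      (1 + PowerSeries.C w * PowerSeries.X) =
        1 - PowerSeries.C (w ^ 2) * PowerSeries.X ^ 2 := by
      rw [map_pow]; ring
    rw [e]
    ext n
    rw [mul_sub, mul_one, map_sub]
    rw [show dD d * (PowerSeries.C (w ^ 2) * PowerSeries.X ^ 2) =
      PowerSeries.C (w ^ 2) * (dD d * PowerSeries.X ^ 2) by ring,
      PowerSeries.coeff_C_mul, PowerSeries.coeff_mul_X_pow', PowerSeries.coeff_C]
    simp only [dD, PowerSeries.coeff_mk, hd]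
    match n with
    | 0 => simp
    | 1 => simp
    | n + 2 =>
      have : (n + 2) % 2 = n % 2 := by omega
      simp only [this]
      split_ifs <;> simp_all <;> ring
  set Y := gs d * (1 - PowerSeries.C w * PowerSeries.X) with hY
  have hXd : PowerSeries.derivative R (PowerSeries.C w * PowerSeries.X) = PowerSeries.C w := by
    rw [Derivation.leibniz]; simp
  have hode : (1 + PowerSeries.C w * PowerSeries.X) * PowerSeries.derivative R Y =
      PowerSeries.C w * Y := by
    rw [hY, Derivation.leibniz, map_sub, hXd, gs_deriv, PowerSeries.derivative_one]
    simp only [smul_eq_mul]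
    rw [map_mul] at hD
    have h2 : (PowerSeries.C (2 : R)) = 2 := map_ofNat _ 2
    rw [h2] at hD
    linear_combination gs d * hD
  have hc : ∀ n : ℕ, ((n : R) + 1) * PowerSeries.coeff (n + 1) Y =
      w * (1 - n) * PowerSeries.coeff n Y := by
    intro n
    have := congrArg (PowerSeries.coeff n) hode
    rw [add_mul, one_mul, map_add, mul_assoc, PowerSeries.coeff_C_mul, PowerSeries.coeff_C_mul,
      PowerSeries.coeff_derivative] at this
    cases n with
    | zero => simp at this ⊢; exact this
    | succ n =>
      rw [PowerSeries.coeff_succ_X_mul, PowerSeries.coeff_derivative] at this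
      push_cast at this ⊢
      linear_combination this
  have h0 : PowerSeries.coeff 0 Y = 1 := by
    rw [hY, PowerSeries.coeff_mul]
    simp [-PowerSeries.coeff_zero_eq_constantCoeff, gs_const]
  have h1 : PowerSeries.coeff 1 Y = w := by
    have := hc 0; rw [h0] at this; simpa using this
  have h2 : ∀ n, PowerSeries.coeff (n + 2) Y = 0 := by
    intro n
    induction n with
    | zero =>
      have := hc 1
      apply (isUnit_succ (R := R) 1).mul_left_cancel
      rw [this]; simp
    | succ n ih =>
      have := hc (n + 2)
      apply (isUnit_succ (R := R) (n + 2)).mul_left_cancel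
      rw [this, ih]; simp
  ext n
  match n with
  | 0 => rw [h0]; simp
  | 1 => rw [h1]; simp [PowerSeries.coeff_one]
  | n + 2 =>
    rw [h2, map_add, PowerSeries.coeff_C_mul, PowerSeries.coeff_X, PowerSeries.coeff_one]; simp

end

section PfFull
variable {R : Type*} [CommRing R] {K : Type*} [Fintype K] [DecidableEq K]
  {ι : Type*} [Fintype ι] [DecidableEq ι]

/-- one signed term -/
def pterm (e : K × Bool ≃ ι) (A : Matrix ι ι R) (σ : Equiv.Perm ι) : R :=
  (Equiv.Perm.sign σ : ℤ) • ∏ i : K, A (σ (e (i, false))) (σ (e (i, true)))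

/-- full (unnormalized) Pfaffian -/
def pfF (e : K × Bool ≃ ι) (A : Matrix ι ι R) : R := ∑ σ : Equiv.Perm ι, pterm e A σ

lemma pfF_map {S : Type*} [CommRing S] (φ : R →+* S) (e : K × Bool ≃ ι) (A : Matrix ι ι R) :
    φ (pfF e A) = pfF e (A.map φ) := by
  simp [pfF, pterm, map_sum, map_prod]

lemma pfF_congr (e : K × Bool ≃ ι) (B A : Matrix ι ι R) :
    pfF e (B * A * B.transpose) = B.det * pfF e A := by
  classical
  have h1 : ∀ σ : Equiv.Perm ι, ∏ i : K, (B * A * B.transpose) (σ (e (i, false))) (σ (e (i, true)))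
      = ∑ f : ι → ι, (∏ i : K, A (f (e (i, false))) (f (e (i, true)))) *
          ∏ x : ι, B (σ x) (f x) := by
    intro σ
    have : ∀ i : K, (B * A * B.transpose) (σ (e (i, false))) (σ (e (i, true))) =
        ∑ p : ι × ι, A p.1 p.2 * (B (σ (e (i, false))) p.1 * B (σ (e (i, true))) p.2) := by
      intro i
      simp only [Matrix.mul_apply, Matrix.transpose_apply, Finset.sum_mul]
      rw [Fintype.sum_prod_type, Finset.sum_comm]
      exact Finset.sum_congr rfl fun _ _ => Finset.sum_congr rfl fun _ _ => by ring
    simp only [this]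
    rw [Finset.prod_univ_sum, Fintype.piFinset_univ]
    let E : (ι → ι) ≃ (K → ι × ι) :=
      { toFun := fun f i => (f (e (i, false)), f (e (i, true)))
        invFun := fun g x => if (e.symm x).2 then (g (e.symm x).1).2 else (g (e.symm x).1).1
        left_inv := by
          intro f; funext x
          obtain ⟨⟨i, b⟩, rfl⟩ := e.surjective x
          cases b <;> simp
        right_inv := by intro g; funext i; simp }
    rw [← Equiv.sum_comp E]
    refine Finset.sum_congr rfl fun f _ => ?_
    rw [Finset.prod_mul_distrib, ← Equiv.prod_comp e, Fintype.prod_prod_type]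
    simp [E, mul_comm]
  have h2 : pfF e (B * A * B.transpose) = ∑ f : ι → ι,
      (∏ i : K, A (f (e (i, false))) (f (e (i, true)))) * (B.submatrix id f).det := by
    simp only [pfF, pterm, h1, Finset.smul_sum]
    rw [Finset.sum_comm]
    refine Finset.sum_congr rfl fun f _ => ?_
    rw [Matrix.det_apply, Finset.mul_sum]
    refine Finset.sum_congr rfl fun σ _ => ?_
    simp [Matrix.submatrix_apply, Units.smul_def]
    ring
  rw [h2]
  have h3 : ∀ f : ι → ι, ¬ Function.Injective f → (B.submatrix id f).det = 0 := by
    intro f hf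
    rw [Function.Injective] at hf
    push Not at hf
    obtain ⟨a, b, hab, hne⟩ := hf
    exact Matrix.det_zero_of_column_eq hne (fun k => by simp [hab])
  have h4 : ∑ f : ι → ι,
      (∏ i : K, A (f (e (i, false))) (f (e (i, true)))) * (B.submatrix id f).det =
      ∑ σ : Equiv.Perm ι,
      (∏ i : K, A (σ (e (i, false))) (σ (e (i, true)))) * (B.submatrix id σ).det := by
    symm
    refine Finset.sum_of_injOn (fun σ : Equiv.Perm ι => (σ : ι → ι)) ?_ ?_ ?_ ?_
    · intro a _ b _ h; exact DFunLike.coe_injective h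
    · intro a _; simp
    · intro f _ hf
      rw [h3, mul_zero]
      intro hi
      apply hf
      have hb : Function.Bijective f := Finite.injective_iff_bijective.mp hi
      exact ⟨Equiv.ofBijective f hb, by simp, rfl⟩
    · intro a _; rfl
  rw [h4, pfF, Finset.mul_sum]
  refine Finset.sum_congr rfl fun σ _ => ?_
  rw [Matrix.det_permute', pterm]
  simp; ring

lemma pfF_swap [NoZeroDivisors R] [CharZero R] (e : K × Bool ≃ ι) (A : Matrix ι ι R) (a b : ι)
    (hab : a ≠ b) (h : A.submatrix (Equiv.swap a b) (Equiv.swap a b) = A) : pfF e A = 0 := by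
  have h1 : pfF e (A.submatrix (Equiv.swap a b) (Equiv.swap a b)) = - pfF e A := by
    unfold pfF
    rw [← Equiv.sum_comp (Equiv.mulLeft (Equiv.swap a b)) (fun σ => pterm e A σ),
      ← Finset.sum_neg_distrib]
    refine Finset.sum_congr rfl fun σ _ => ?_
    simp [pterm, Equiv.Perm.sign_swap hab]
  rw [h] at h1
  exact self_eq_neg.mp h1

/-- normalization -/
lemma pfF_norm (e : K × Bool ≃ ι) (A : Matrix ι ι R)
    (cond : Equiv.Perm ι → Prop) [DecidablePred cond]
    (H : Finset (Equiv.Perm ι))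
    (hH : ∀ h ∈ H, ∀ σ, pterm e A (σ * h) = pterm e A σ)
    (hu : ∀ σ, ∃! h, h ∈ H ∧ cond (σ * h)) :
    pfF e A = (H.card : R) * ∑ σ, if cond σ then pterm e A σ else 0 := by
  have h1 : ∀ σ, pterm e A σ = ∑ h ∈ H, if cond (σ * h) then pterm e A (σ * h) else 0 := by
    intro σ
    obtain ⟨h, ⟨hh, hc⟩, huq⟩ := hu σ
    rw [Finset.sum_eq_single h]
    · rw [if_pos hc, hH h hh]
    · intro b hb hne
      rw [if_neg]
      intro hcb
      exact hne (huq b ⟨hb, hcb⟩)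
    · intro hn; exact absurd hh hn
  unfold pfF
  rw [Finset.sum_congr rfl (fun σ _ => h1 σ), Finset.sum_comm]
  have : ∀ h ∈ H, (∑ σ, if cond (σ * h) then pterm e A (σ * h) else 0) =
      ∑ σ, if cond σ then pterm e A σ else 0 := by
    intro h _
    exact Equiv.sum_comp (Equiv.mulRight h) (fun σ => if cond σ then pterm e A σ else 0)
  rw [Finset.sum_congr rfl this]
  simp

end PfFull

section Bord
variable {R : Type*} [CommRing R] {K : Type*} [Fintype K] [DecidableEq K] {m : ℕ}

/-- bordered matrix -/
def bord (r : Fin m → R) (A : Matrix (Fin m) (Fin m) R) :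
    Matrix (Fin (m + 1)) (Fin (m + 1)) R :=
  Matrix.of fun i j =>
    Fin.cases (motive := fun _ => R) (Fin.cases (motive := fun _ => R) 0 r j)
      (fun i' => Fin.cases (motive := fun _ => R) (- r i') (A i') j) i

@[simp] lemma bord_00 (r : Fin m → R) (A) : bord r A 0 0 = 0 := rfl
@[simp] lemma bord_0s (r : Fin m → R) (A) (j : Fin m) : bord r A 0 j.succ = r j := rfl
@[simp] lemma bord_s0 (r : Fin m → R) (A) (j : Fin m) : bord r A j.succ 0 = - r j := rfl
@[simp] lemma bord_ss (r : Fin m → R) (A) (i j : Fin m) : bord r A i.succ j.succ = A i j := rfl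

lemma bord_map {S : Type*} [CommRing S] (φ : R →+* S) (r : Fin m → R)
    (A : Matrix (Fin m) (Fin m) R) :
    (bord r A).map φ = bord (fun j => φ (r j)) (A.map φ) := by
  ext i j
  refine Fin.cases ?_ (fun i => ?_) i <;> refine Fin.cases ?_ (fun j => ?_) j <;> simp

/-- cofactors -/
def cof (e : K × Bool ≃ Fin (m + 1)) (A : Matrix (Fin m) (Fin m) R) (j : Fin m) : R :=
  pfF e (bord (Pi.single j 1) A)

lemma cof_map {S : Type*} [CommRing S] (φ : R →+* S) (e : K × Bool ≃ Fin (m + 1))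
    (A : Matrix (Fin m) (Fin m) R) (j : Fin m) :
    φ (cof e A j) = cof e (A.map φ) j := by
  unfold cof
  rw [pfF_map, bord_map]
  congr 2
  funext i
  by_cases h : i = j
  · subst h; simp
  · simp [h]

lemma pfF_bord (e : K × Bool ≃ Fin (m + 1)) (r : Fin m → R) (A : Matrix (Fin m) (Fin m) R) :
    pfF e (bord r A) = ∑ j, r j * cof e A j := by
  unfold cof pfF
  simp only [Finset.mul_sum]
  rw [Finset.sum_comm]
  refine Finset.sum_congr rfl fun σ _ => ?_
  simp only [pterm, mul_smul_comm]
  rw [← Finset.smul_sum]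
  congr 1
  set i0 : K := (e.symm (σ.symm 0)).1 with hi0
  have hne : ∀ i, i ≠ i0 → ∀ b, σ (e (i, b)) ≠ 0 := by
    intro i hi b h0
    apply hi
    rw [hi0, ← h0]; simp
  have hind : ∀ (r r' : Fin m → R) (i : K), i ≠ i0 →
      bord r A (σ (e (i, false))) (σ (e (i, true))) =
      bord r' A (σ (e (i, false))) (σ (e (i, true))) := by
    intro r r' i hi
    obtain ⟨a, ha⟩ := Fin.exists_succ_eq.mpr (hne i hi false)
    obtain ⟨b, hb⟩ := Fin.exists_succ_eq.mpr (hne i hi true)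
    rw [← ha, ← hb]; simp
  have hlin : ∀ x y : Fin (m + 1), (x = 0 ∨ y = 0) →
      bord r A x y = ∑ j, r j * bord (Pi.single j 1) A x y := by
    intro x y hxy
    induction x using Fin.cases <;> induction y using Fin.cases
    · simp
    · simp [Pi.single_apply]
    · simp [Pi.single_apply]
    · simp at hxy
  have h0 : σ (e (i0, false)) = 0 ∨ σ (e (i0, true)) = 0 := by
    have : σ (e (e.symm (σ.symm 0))) = 0 := by simp
    rw [show e.symm (σ.symm 0) = (i0, (e.symm (σ.symm 0)).2) from rfl] at this
    cases hb : (e.symm (σ.symm 0)).2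
    · left; rw [hb] at this; exact this
    · right; rw [hb] at this; exact this
  rw [← Finset.mul_prod_erase _ _ (Finset.mem_univ i0), hlin _ _ h0, Finset.sum_mul]
  refine Finset.sum_congr rfl fun j _ => ?_
  rw [← Finset.mul_prod_erase _ (fun i => bord (Pi.single j 1) A _ _) (Finset.mem_univ i0), mul_assoc]
  congr 2
  refine Finset.prod_congr rfl fun i hi => ?_
  exact hind _ _ i (Finset.ne_of_mem_erase hi)

lemma pfF_bord_add (e : K × Bool ≃ Fin (m + 1)) (r u : Fin m → R)
    (A A' : Matrix (Fin m) (Fin m) R) (h : ∀ i j, A' i j = A i j + u i * r j - u j * r i) :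
    pfF e (bord r A') = pfF e (bord r A) := by
  let B : Matrix (Fin (m + 1)) (Fin (m + 1)) R :=
    1 + Matrix.of fun i j => if j = 0 then Fin.cases (motive := fun _ => R) 0 u i else 0
  have hB : B.det = 1 := by
    rw [Matrix.det_of_isLowerTriangular]
    · apply Finset.prod_eq_one
      intro i _
      refine Fin.cases ?_ (fun i => ?_) i <;> simp [B]
    · intro i j hij
      have hij' : i < j := hij
      have : j ≠ 0 := by intro h; subst h; exact absurd hij' (Fin.not_lt_zero i)
      simp [B, this, Matrix.one_apply, hij'.ne]
  have hBA : bord r A' = B * bord r A * B.transpose := by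
    have hl : ∀ (M : Matrix (Fin (m + 1)) (Fin (m + 1)) R) i j, (B * M) i j =
        M i j + Fin.cases (motive := fun _ => R) 0 u i * M 0 j := by
      intro M i j
      simp [B, add_mul, Matrix.mul_apply, Finset.sum_add_distrib, Matrix.one_apply]
    have hr : ∀ (M : Matrix (Fin (m + 1)) (Fin (m + 1)) R) i j, (M * B.transpose) i j =
        M i j + Fin.cases (motive := fun _ => R) 0 u j * M i 0 := by
      intro M i j
      simp [B, mul_add, Matrix.mul_apply, mul_comm, Finset.sum_add_distrib, Matrix.one_apply]
    ext i j
    rw [hr, hl, hl]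
    refine Fin.cases ?_ (fun i => ?_) i <;> refine Fin.cases ?_ (fun j => ?_) j <;> simp [h]
    ring
  rw [hBA, pfF_congr, hB, one_mul]

lemma cof_orth [NoZeroDivisors R] [CharZero R] (e : K × Bool ≃ Fin (m + 1))
    (A : Matrix (Fin m) (Fin m) R) (hA : ∀ i j, A i j = - A j i) (i : Fin m) :
    ∑ j, A i j * cof e A j = 0 := by
  rw [← pfF_bord e (A i) A]
  have hd : ∀ i, A i i = 0 := fun i => self_eq_neg.mp (hA i i)
  apply pfF_swap e _ 0 i.succ (Fin.succ_ne_zero i).symm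
  have hs : ∀ x : Fin m, x ≠ i → Equiv.swap 0 i.succ x.succ = x.succ := by
    intro x hx
    apply Equiv.swap_apply_of_ne_of_ne (Fin.succ_ne_zero x)
    simpa using hx
  ext x y
  refine Fin.cases ?_ (fun x => ?_) x <;> refine Fin.cases ?_ (fun y => ?_) y
  · simp [hd]
  · by_cases hy : y = i
    · subst hy; simp [hd]
    · simp [hs y hy]
  · by_cases hx : x = i
    · subst hx; simp [hd]
    · simp [hs x hx]; rw [hA]
  · by_cases hx : x = i <;> by_cases hy : y = i
    · subst hx; subst hy; simp [hd]
    · subst hx; simp [hs y hy]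
    · subst hy; simp [hs x hx]; rw [hA, neg_neg]
    · simp [hs x hx, hs y hy]

end Bord

section Norm

/-- pairs -/
def pairE (m : ℕ) (hm : m % 2 = 0) : Fin (m / 2) × Bool ≃ Fin m where
  toFun p := match p with
    | (i, false) => ⟨2 * i.val, by have := i.isLt; omega⟩
    | (i, true) => ⟨2 * i.val + 1, by have := i.isLt; omega⟩
  invFun x := (⟨x.val / 2, by have := x.isLt; omega⟩, decide (x.val % 2 = 1))
  left_inv := by
    rintro ⟨i, _ | _⟩
    · simp
    · simp; ext; simp; omega
  right_inv := by
    intro x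
    by_cases h : x.val % 2 = 1
    · simp only [h, decide_true]; ext; simp; omega
    · simp only [h, decide_false]; ext; simp; omega

variable {K : Type*} [Fintype K] [DecidableEq K] {ι : Type*} [Fintype ι] [DecidableEq ι]

/-- hyperoctahedral elements -/
def hyp (e : K × Bool ≃ ι) (p : Equiv.Perm K × (K → Equiv.Perm Bool)) : Equiv.Perm ι :=
  e.permCongr (Equiv.prodCongrLeft (fun _ : Bool => p.1) * Equiv.prodCongrRight p.2)

lemma hyp_apply (e : K × Bool ≃ ι) (p : Equiv.Perm K × (K → Equiv.Perm Bool)) (i : K) (b : Bool) :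
    hyp e p (e (i, b)) = e (p.1 i, p.2 i b) := by
  simp [hyp, Equiv.permCongr_apply]

lemma hyp_sign (e : K × Bool ≃ ι) (p : Equiv.Perm K × (K → Equiv.Perm Bool)) :
    Equiv.Perm.sign (hyp e p) = ∏ i, Equiv.Perm.sign (p.2 i) := by
  simp [hyp, Equiv.Perm.sign_permCongr, Equiv.Perm.sign_prodCongrLeft,
    Equiv.Perm.sign_prodCongrRight, Equiv.Perm.sign_mul]

lemma permBool (c : Equiv.Perm Bool) : c = 1 ∨ c = Equiv.swap false true := by
  revert c; decide

lemma hyp_inv {R : Type*} [CommRing R] (e : K × Bool ≃ ι) (A : Matrix ι ι R)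
    (hA : ∀ x y, A x y = - A y x)
    (p : Equiv.Perm K × (K → Equiv.Perm Bool)) (σ : Equiv.Perm ι) :
    pterm e A (σ * hyp e p) = pterm e A σ := by
  unfold pterm
  rw [← Equiv.prod_comp p.1 (fun i => A (σ (e (i, false))) (σ (e (i, true))))]
  have h1 : ∀ i, A ((σ * hyp e p) (e (i, false))) ((σ * hyp e p) (e (i, true))) =
      (((Equiv.Perm.sign (p.2 i) : ℤˣ) : ℤ) : R) *
        A (σ (e (p.1 i, false))) (σ (e (p.1 i, true))) := by
    intro i
    simp only [Equiv.Perm.mul_apply, hyp_apply]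
    rcases permBool (p.2 i) with h | h
    · rw [h]; simp
    · rw [h, Equiv.Perm.sign_swap (by decide)]
      simp; rw [hA]
  simp only [h1]
  rw [Finset.prod_mul_distrib, Equiv.Perm.sign_mul, hyp_sign]
  simp only [zsmul_eq_mul]
  push_cast
  have h2 : (∏ i, (((Equiv.Perm.sign (p.2 i) : ℤˣ) : ℤ) : R)) *
      (∏ i, (((Equiv.Perm.sign (p.2 i) : ℤˣ) : ℤ) : R)) = 1 := by
    rw [← Finset.prod_mul_distrib]
    apply Finset.prod_eq_one
    intro i _
    rw [← Int.cast_mul, ← Units.val_mul, Int.units_mul_self]; simp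
  linear_combination ((((Equiv.Perm.sign σ : ℤˣ) : ℤ) : R) *
    ∏ i, A (σ (e (p.1 i, false))) (σ (e (p.1 i, true)))) * h2

lemma hyp_unique {k m : ℕ} (e : Fin k × Bool ≃ Fin m) (σ : Equiv.Perm (Fin m)) :
    ∃! h, h ∈ Finset.univ.image (hyp e) ∧
      ((∀ i, (σ * h) (e (i, false)) < (σ * h) (e (i, true))) ∧
       (∀ i j, i < j → (σ * h) (e (i, false)) < (σ * h) (e (j, false)))) := by
  classical
  let lo : Fin k → Equiv.Perm Bool := fun j =>
    if σ (e (j, false)) < σ (e (j, true)) then 1 else Equiv.swap false true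
  have hne : ∀ j, σ (e (j, false)) ≠ σ (e (j, true)) := by
    intro j h; simpa using e.injective (σ.injective h)
  have hlo : ∀ j, σ (e (j, lo j false)) < σ (e (j, lo j true)) := by
    intro j
    by_cases h : σ (e (j, false)) < σ (e (j, true))
    · simp [lo, h]
    · simp only [lo, h, if_false, Equiv.swap_apply_left, Equiv.swap_apply_right]
      exact lt_of_le_of_ne (not_lt.mp h) (hne j).symm
  have hlou : ∀ j (c : Equiv.Perm Bool), σ (e (j, c false)) < σ (e (j, c true)) → c = lo j := by
    intro j c hc
    rcases permBool c with h | h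
    · subst h
      simp only [Equiv.Perm.one_apply] at hc
      simp [lo, hc]
    · subst h
      simp only [Equiv.swap_apply_left, Equiv.swap_apply_right] at hc
      simp [lo, not_lt.mpr hc.le]
  let μ : Fin k → Fin m := fun j => σ (e (j, lo j false))
  have hμ : Function.Injective μ := by
    intro a b hab
    have := e.injective (σ.injective hab)
    exact (Prod.mk.inj this).1
  let π : Equiv.Perm (Fin k) := Tuple.sort μ
  have hπ : StrictMono (μ ∘ π) :=
    (Tuple.monotone_sort μ).strictMono_of_injective (hμ.comp π.injective)
  refine ⟨hyp e (π, fun i => lo (π i)), ⟨by simp, ?_, ?_⟩, ?_⟩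
  · intro i
    simp only [Equiv.Perm.mul_apply, hyp_apply]
    exact hlo _
  · intro i j hij
    simp only [Equiv.Perm.mul_apply, hyp_apply]
    exact hπ hij
  · rintro h ⟨hh, h1, h2⟩
    obtain ⟨⟨π', c⟩, -, rfl⟩ := Finset.mem_image.mp hh
    simp only [Equiv.Perm.mul_apply, hyp_apply] at h1 h2
    have hc : c = fun i => lo (π' i) := by
      funext i; exact hlou _ _ (h1 i)
    subst hc
    have hπ' : StrictMono (μ ∘ π') := fun i j hij => h2 i j hij
    have : μ ∘ π' = μ ∘ π := by
      apply (hπ'.range_inj hπ).mp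
      rw [π'.surjective.range_comp, π.surjective.range_comp]
    have : π' = π := by
      ext i
      have h3 := hμ (congrFun this i)
      rw [h3]
    rw [this]

lemma pfaffian_norm {m : ℕ} (hm : m % 2 = 0) :
    ∃ N : ℕ, N ≠ 0 ∧ ∀ {R : Type} [CommRing R] (A : Matrix (Fin m) (Fin m) R),
      (∀ x y, A x y = - A y x) → pfF (pairE m hm) A = (N : R) * pfaffian A := by
  classical
  refine ⟨(Finset.univ.image (hyp (pairE m hm))).card, ?_, ?_⟩
  · rw [Finset.card_ne_zero]
    exact Finset.univ_nonempty.image _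
  · intro R _ A hA
    rw [pfF_norm (pairE m hm) A (fun σ => pfaffianCond σ) (Finset.univ.image (hyp (pairE m hm)))]
    · unfold pfaffian
      congr 1
    · intro h hh σ
      obtain ⟨p, -, rfl⟩ := Finset.mem_image.mp hh
      exact hyp_inv _ A hA p σ
    · intro σ
      exact hyp_unique (pairE m hm) σ

end Norm

section Chi
variable {R : Type*} [CommRing R]

/-- twice chi -/
def chi2 (s s' : ℕ → R) (l μ : ℕ) : R :=
  s l * s' μ + 2 * ∑ ℓ ∈ Finset.Icc 1 μ, (-1) ^ ℓ * (s (l + ℓ) * s' (μ - ℓ))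

lemma sum_Icc_one (f : ℕ → R) (μ : ℕ) :
    ∑ ℓ ∈ Finset.Icc 1 μ, f ℓ = ∑ ℓ ∈ Finset.range μ, f (ℓ + 1) := by
  rw [Finset.range_eq_Ico, Finset.sum_Ico_add' f 0 μ 1]
  rfl

lemma chi2_zero (s s' : ℕ → R) (l : ℕ) : chi2 s s' l 0 = s l * s' 0 := by
  simp [chi2]

lemma chi2_rec (s s' : ℕ → R) (l μ : ℕ) :
    chi2 s s' l (μ + 1) = s l * s' (μ + 1) - s (l + 1) * s' μ - chi2 s s' (l + 1) μ := by
  unfold chi2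
  rw [sum_Icc_one, sum_Icc_one, Finset.sum_range_succ']
  have : ∑ k ∈ Finset.range μ, (-1 : R) ^ (k + 1 + 1) *
      (s (l + (k + 1 + 1)) * s' (μ + 1 - (k + 1 + 1))) =
      - ∑ ℓ ∈ Finset.range μ, (-1) ^ (ℓ + 1) * (s (l + 1 + (ℓ + 1)) * s' (μ - (ℓ + 1))) := by
    rw [← Finset.sum_neg_distrib]
    refine Finset.sum_congr rfl fun k _ => ?_
    rw [show l + (k + 1 + 1) = l + 1 + (k + 1) by omega,
      show μ + 1 - (k + 1 + 1) = μ - (k + 1) by omega]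
    ring
  rw [this]
  simp
  ring

lemma chi2_map {S : Type*} [CommRing S] (φ : R →+* S) (s s' : ℕ → R) (l μ : ℕ) :
    φ (chi2 s s' l μ) = chi2 (fun n => φ (s n)) (fun n => φ (s' n)) l μ := by
  simp [chi2, map_sum, map_ofNat]

lemma chi2_shift (v : R) (s s' σ σ' : ℕ → R)
    (h : ∀ n, σ (n + 1) = v * σ n + s (n + 1) + v * s n)
    (h' : ∀ n, σ' (n + 1) = v * σ' n + s' (n + 1) + v * s' n)
    (h0 : s' 0 = 1) (h1 : σ' 0 = 1) (l μ : ℕ) :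
    chi2 σ σ' l μ = chi2 s s' l μ + σ l * s' μ - s l * σ' μ := by
  induction μ generalizing l with
  | zero => rw [chi2_zero, chi2_zero, h0, h1]; ring
  | succ μ ih =>
    rw [chi2_rec, ih, chi2_rec, h, h']
    ring

/-- `chi2 + transposed` only depends on alternating convolution. -/
lemma chi2_anti (s s' r r' : ℕ → R)
    (h : ∀ n, ∑ p ∈ Finset.HasAntidiagonal.antidiagonal n, (-1) ^ p.1 * s' p.1 * s p.2 =
      ∑ p ∈ Finset.HasAntidiagonal.antidiagonal n, (-1) ^ p.1 * r' p.1 * r p.2) (l μ : ℕ) :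
    chi2 s s' l μ + chi2 s' s μ l = chi2 r r' l μ + chi2 r' r μ l := by
  have key : ∀ (s s' : ℕ → R) (l : ℕ), chi2 s s' l 0 + chi2 s' s 0 l =
      2 * ∑ p ∈ Finset.HasAntidiagonal.antidiagonal l, (-1) ^ p.1 * s' p.1 * s p.2 := by
    intro s s' l
    rw [Finset.Nat.sum_antidiagonal_eq_sum_range_succ_mk, Finset.sum_range_succ', chi2_zero, chi2,
      sum_Icc_one]
    simp
    have : ∀ k ∈ Finset.range l, (-1) ^ (k + 1) * s' (k + 1) * s (l - (k + 1)) =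
      (-1) ^ (k + 1) * (s' (k + 1) * s (l - (k + 1))) := fun k _ => by ring
    rw [Finset.sum_congr rfl this]
    ring
  induction μ generalizing l with
  | zero => rw [key, key, h]
  | succ μ ih =>
    have a1 := chi2_rec s' s μ l
    have a2 := chi2_rec r' r μ l
    rw [chi2_rec s, chi2_rec r]
    linear_combination -ih (l + 1) + a1 - a2

/-- the functional `w^k ↦ E_k` -/
def phi (E : ℕ → R) : Polynomial R →ₗ[R] R :=
  Polynomial.lsum fun k => (E k) • LinearMap.id

lemma phi_monomial (E : ℕ → R) (k : ℕ) (a : R) :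
    phi E (Polynomial.C a * Polynomial.X ^ k) = a * E k := by
  rw [Polynomial.C_mul_X_pow_eq_monomial]
  simp [phi, Polynomial.lsum_apply, mul_comm]

lemma phi_C_mul (E : ℕ → R) (a : R) (p : Polynomial R) :
    phi E (Polynomial.C a * p) = a * phi E p := by
  rw [← Polynomial.smul_eq_C_mul, map_smul, smul_eq_mul]

lemma phi_C (E : ℕ → R) (a : R) : phi E (Polynomial.C a) = a * E 0 := by
  have := phi_monomial E 0 a
  simpa using this

/-- shifted sequence -/
def shE (E : ℕ → R) : ℕ → R := fun n => match n with
  | 0 => 0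
  | k + 1 => E k

lemma phi_X_mul (E : ℕ → R) (p : Polynomial R) :
    phi (shE E) (Polynomial.X * p) = phi E p := by
  induction p using Polynomial.induction_on' with
  | add p q hp hq => rw [mul_add, map_add, map_add, hp, hq]
  | monomial n a =>
    rw [← Polynomial.C_mul_X_pow_eq_monomial, phi_monomial,
      show Polynomial.X * (Polynomial.C a * Polynomial.X ^ n) =
        Polynomial.C a * Polynomial.X ^ (n + 1) by ring, phi_monomial]
    rfl

lemma phi_sigma (E : ℕ → R) (hE : E 0 = 1) (ε : R) (a a' : ℕ → R) (σ : ℕ → Polynomial R)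
    (ha0 : a 0 = 1)
    (h0 : σ 0 = 1) (h : ∀ n, σ (n + 1) = (Polynomial.C ε * Polynomial.X) * σ n +
      Polynomial.C (a (n + 1)) + (Polynomial.C ε * Polynomial.X) * Polynomial.C (a n))
    (ha : ∀ n, a' n = ∑ p ∈ Finset.HasAntidiagonal.antidiagonal n, ε ^ p.1 * E p.1 * a p.2) (n : ℕ) :
    phi E (σ n) = 2 * a' n - a n := by
  have h1 : ∀ n, σ n + Polynomial.C (a n) = 2 * ∑ p ∈ Finset.HasAntidiagonal.antidiagonal n,
      Polynomial.C (ε ^ p.1 * a p.2) * Polynomial.X ^ p.1 := by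
    intro n
    induction n with
    | zero => simp [h0, ha0]; norm_num
    | succ n ih =>
      rw [Finset.Nat.sum_antidiagonal_succ]
      have : ∑ p ∈ Finset.HasAntidiagonal.antidiagonal n, Polynomial.C (ε ^ (p.1 + 1) * a p.2) *
          Polynomial.X ^ (p.1 + 1) = (Polynomial.C ε * Polynomial.X) *
          ∑ p ∈ Finset.HasAntidiagonal.antidiagonal n, Polynomial.C (ε ^ p.1 * a p.2) * Polynomial.X ^ p.1 := by
        rw [Finset.mul_sum]
        refine Finset.sum_congr rfl fun p _ => ?_
        simp only [map_mul, map_pow]; ring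
      rw [this, h]
      simp only [pow_zero, one_mul, mul_one]
      linear_combination (Polynomial.C ε * Polynomial.X) * ih
  have h2 := congrArg (phi E) (h1 n)
  rw [map_add, phi_C, hE, mul_one] at h2
  rw [show (2 : Polynomial R) = Polynomial.C 2 from (map_ofNat _ 2).symm, phi_C_mul, map_sum] at h2
  simp only [phi_monomial] at h2
  rw [ha]
  have : ∑ p ∈ Finset.HasAntidiagonal.antidiagonal n, ε ^ p.1 * E p.1 * a p.2 =
    ∑ x ∈ Finset.HasAntidiagonal.antidiagonal n, ε ^ x.1 * a x.2 * E x.1 :=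
      Finset.sum_congr rfl fun p _ => by ring
  rw [this]
  linear_combination h2

lemma main_chi (E : ℕ → R) (hE : E 0 = 1) (a a' b b' : ℕ → R) (σ σ' : ℕ → Polynomial R)
    (h0 : σ 0 = 1) (h0' : σ' 0 = 1) (a0 : a 0 = 1) (b0 : b 0 = 1) (a0' : a' 0 = 1) (b0' : b' 0 = 1)
    (h : ∀ n, σ (n + 1) = (Polynomial.C (-1) * Polynomial.X) * σ n +
      Polynomial.C (a (n + 1)) + (Polynomial.C (-1) * Polynomial.X) * Polynomial.C (a n))
    (h' : ∀ n, σ' (n + 1) = (Polynomial.C 1 * Polynomial.X) * σ' n +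
      Polynomial.C (b' (n + 1)) + (Polynomial.C 1 * Polynomial.X) * Polynomial.C (b' n))
    (ha : ∀ n, a' n = ∑ p ∈ Finset.HasAntidiagonal.antidiagonal n, (-1) ^ p.1 * E p.1 * a p.2)
    (hb : ∀ n, b n = ∑ p ∈ Finset.HasAntidiagonal.antidiagonal n, 1 ^ p.1 * E p.1 * b' p.2) (l μ : ℕ) :
    phi E (σ l * σ' μ) = a l * b' μ + 2 * (chi2 a' b' l μ - chi2 a b l μ) := by
  have p1 := phi_sigma E hE (-1) a a' σ a0 h0 h ha
  have p2 := phi_sigma E hE 1 b' b σ' b0' h0' h' hb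
  have q1 : ∀ n, phi (shE E) (σ (n + 1)) = - 2 * a' n := by
    intro n
    rw [h, show (Polynomial.C (-1) * Polynomial.X) * σ n +
      Polynomial.C (a (n + 1)) + (Polynomial.C (-1) * Polynomial.X) * Polynomial.C (a n) =
      Polynomial.C (-1) * (Polynomial.X * σ n) + Polynomial.C (a (n + 1)) +
      Polynomial.C (-1) * (Polynomial.X * Polynomial.C (a n)) by ring,
      map_add, map_add, phi_C_mul, phi_C_mul, phi_X_mul, phi_X_mul, phi_C, phi_C, p1, hE]
    simp only [shE]; ring
  have q2 : ∀ n, phi (shE E) (σ' (n + 1)) = 2 * b n := by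
    intro n
    rw [h', map_one, one_mul, map_add, map_add, phi_X_mul, phi_X_mul, phi_C, phi_C, p2, hE]
    simp only [shE]; ring
  induction μ generalizing l with
  | zero =>
    rw [chi2_zero, chi2_zero, h0', mul_one, p1, b0, b0']; ring
  | succ μ ih =>
    have key : phi E (σ l * σ' (μ + 1)) + phi E (σ (l + 1) * σ' μ) =
        2 * a (l + 1) * b μ - a l * (2 * b (μ + 1) - b' (μ + 1))
          + 2 * a' l * b' (μ + 1) - b' μ * (2 * a' (l + 1) - a (l + 1)) := by
      rw [← map_add, ← phi_X_mul]
      have e : Polynomial.X * (σ l * σ' (μ + 1) + σ (l + 1) * σ' μ) =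
          Polynomial.C (a (l + 1)) * σ' (μ + 1) - Polynomial.C (a l) * (Polynomial.X * σ' (μ + 1))
          - Polynomial.C (b' (μ + 1)) * σ (l + 1)
          - Polynomial.C (b' μ) * (Polynomial.X * σ (l + 1)) := by
        have e1 := h l
        have e2 := h' μ
        rw [map_neg, map_one] at e1
        rw [map_one] at e2
        linear_combination (σ' (μ + 1)) * e1 - (σ (l + 1)) * e2
      rw [e, map_sub, map_sub, map_sub, phi_C_mul, phi_C_mul, phi_C_mul, phi_C_mul,
        phi_X_mul, phi_X_mul, p1, p2, q1, q2]
      ring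
    have c1 := chi2_rec a' b' l μ
    have c2 := chi2_rec a b l μ
    linear_combination key - ih (l + 1) - 2 * c1 + 2 * c2

end Chi

section Res

lemma res_sum {R : Type*} [CommRing R] (h h' : ℤ → R) (hh : ∀ m < 0, h m = 0)
    (hh' : ∀ m < 0, h' m = 0) (E : ℕ → R)
    (hE : ∀ n, E n = ∑ p ∈ Finset.HasAntidiagonal.antidiagonal n, h p.1 * h' p.2)
    (P Q : Polynomial R) (N : ℕ) (hP : P.natDegree < N) (hQ : Q.natDegree < N) :
    ∑ᶠ m : ℤ, (∑ k ∈ Finset.range N, h (m + k) * P.coeff k) *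
      (∑ k ∈ Finset.range N, h' (-m + k) * Q.coeff k) = phi E (P * Q) := by
  have h1 : ∑ᶠ m : ℤ, (∑ k ∈ Finset.range N, h (m + k) * P.coeff k) *
      (∑ k ∈ Finset.range N, h' (-m + k) * Q.coeff k) =
      ∑ m ∈ Finset.Icc (-(N : ℤ)) N, (∑ k ∈ Finset.range N, h (m + k) * P.coeff k) *
      (∑ k ∈ Finset.range N, h' (-m + k) * Q.coeff k) := by
    apply finsum_eq_sum_of_support_subset
    intro m hm
    rw [Function.mem_support] at hm
    rw [Finset.coe_Icc, Set.mem_Icc]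
    by_contra hcon
    apply hm
    by_cases hlt : m < -(N : ℤ)
    · rw [Finset.sum_eq_zero, zero_mul]
      intro k hk
      have := Finset.mem_range.mp hk
      rw [hh _ (by omega), zero_mul]
    · rw [mul_comm, Finset.sum_eq_zero, zero_mul]
      intro k hk
      have := Finset.mem_range.mp hk
      rw [hh' _ (by omega), zero_mul]
  have h2 : ∀ k ∈ Finset.range N, ∀ l ∈ Finset.range N,
      ∑ m ∈ Finset.Icc (-(N : ℤ)) N, h (m + k) * h' (-m + l) = E (k + l) := by
    intro k hk l hl
    have hk := Finset.mem_range.mp hk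
    have hl := Finset.mem_range.mp hl
    rw [hE]
    symm
    refine Finset.sum_of_injOn (fun p : ℕ × ℕ => (p.1 : ℤ) - k) ?_ ?_ ?_ ?_
    · rintro ⟨a, b⟩ hab ⟨c, d⟩ hcd heq
      have hab := Finset.HasAntidiagonal.mem_antidiagonal.mp hab
      have hcd := Finset.HasAntidiagonal.mem_antidiagonal.mp hcd
      simp only [Prod.mk.injEq] at *
      constructor <;> omega
    · rintro ⟨a, b⟩ hab
      have hab := Finset.HasAntidiagonal.mem_antidiagonal.mp hab
      simp only [Finset.coe_Icc, Set.mem_Icc] at *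
      constructor <;> omega
    · intro m hm hn
      by_cases hneg : m + k < 0
      · rw [hh _ hneg, zero_mul]
      · by_cases hneg' : -m + l < 0
        · rw [hh' _ hneg', mul_zero]
        · exfalso
          apply hn
          refine ⟨((m + k).toNat, (-m + l).toNat), ?_, ?_⟩
          · rw [Finset.mem_coe, Finset.HasAntidiagonal.mem_antidiagonal]
            simp only; omega
          · simp only; omega
    · rintro ⟨a, b⟩ hab
      have hab := Finset.HasAntidiagonal.mem_antidiagonal.mp hab
      simp only at *
      congr 2
      · ring
      · omega
  rw [h1]
  have h3 : phi E (P * Q) = ∑ k ∈ Finset.range N, ∑ l ∈ Finset.range N,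
      (P.coeff k * Q.coeff l) * E (k + l) := by
    conv_lhs => rw [P.as_sum_range_C_mul_X_pow' hP, Q.as_sum_range_C_mul_X_pow' hQ]
    rw [Finset.sum_mul_sum, map_sum]
    refine Finset.sum_congr rfl fun k _ => ?_
    rw [map_sum]
    refine Finset.sum_congr rfl fun l _ => ?_
    rw [← phi_monomial E (k + l) (P.coeff k * Q.coeff l)]
    congr 1
    rw [Polynomial.C_mul, pow_add]; ring
  rw [h3]
  simp only [Finset.sum_mul_sum]
  rw [Finset.sum_comm]
  refine Finset.sum_congr rfl fun k hk => ?_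
  rw [Finset.sum_comm]
  refine Finset.sum_congr rfl fun l hl => ?_
  rw [← h2 k hk l hl, Finset.mul_sum]
  refine Finset.sum_congr rfl fun m _ => ?_
  ring

/-- the series `E(z)` -/
def Eser : PowerSeries BRing2 :=
  PowerSeries.map inL (gs tTilde) * PowerSeries.map inR (gs (fun j => - tTilde j))

/-- its coefficients -/
def Ec (n : ℕ) : BRing2 := PowerSeries.coeff n Eser

lemma bkp_iff (τ : BRing) : SatisfiesBKP τ ↔
    phi Ec ((shiftMinus τ).map inL * (shiftPlus τ).map inR) = inL τ * inR τ := by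
  unfold SatisfiesBKP
  set N := (shiftMinus τ).natDegree + (shiftPlus τ).natDegree + 1 with hN
  have key := res_sum (fun m => inL (sTildeZ m)) (fun m => inR (sTildeNegZ m))
    (by intro m hm; simp [sTildeZ, not_le.mpr hm])
    (by intro m hm; simp [sTildeNegZ, not_le.mpr hm]) Ec
    (by
      intro n
      rw [Ec, Eser, PowerSeries.coeff_mul]
      simp [coeff_gs, sTildeZ, sTildeNegZ])
    ((shiftMinus τ).map inL) ((shiftPlus τ).map inR) N
    (by have := Polynomial.natDegree_map_le (f := inL) (p := shiftMinus τ); omega)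
    (by have := Polynomial.natDegree_map_le (f := inR) (p := shiftPlus τ); omega)
  rw [← key]
  · have hl : ∀ m, inL (leftCoeff τ m) = ∑ k ∈ Finset.range N, inL (sTildeZ (m + k)) *
        ((shiftMinus τ).map inL).coeff k := by
      intro m
      unfold leftCoeff
      rw [finsum_eq_sum_of_support_subset (s := Finset.range N), map_sum]
      · simp [Polynomial.coeff_map]
      · intro k hk
        rw [Function.mem_support] at hk
        by_contra hcon
        apply hk
        rw [Polynomial.coeff_eq_zero_of_natDegree_lt, mul_zero]
        simp at hcon
        omega
    have hr : ∀ m, inR (rightCoeff τ m) = ∑ k ∈ Finset.range N, inR (sTildeNegZ (m + k)) *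
        ((shiftPlus τ).map inR).coeff k := by
      intro m
      unfold rightCoeff
      rw [finsum_eq_sum_of_support_subset (s := Finset.range N), map_sum]
      · simp [Polynomial.coeff_map]
      · intro k hk
        rw [Function.mem_support] at hk
        by_contra hcon
        apply hk
        rw [Polynomial.coeff_eq_zero_of_natDegree_lt, mul_zero]
        simp at hcon
        omega
    simp only [hl, hr]

end Res

section Shift

lemma shift_rec (ψ : BRing →ₐ[ℂ] Polynomial BRing) (ε : ℂ) (hε : ε ^ 2 = 1)
    (hψ : ∀ i, ψ (X i) = Polynomial.C (X i) + Polynomial.C (C (ε * (2 / ((2 * i + 1 : ℕ) : ℂ)))) *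
      Polynomial.X ^ (2 * i + 1)) (c : ℕ → ℂ) (n : ℕ) :
    ψ (sB (n + 1) (tShift c)) = (Polynomial.C (C ε) * Polynomial.X) * ψ (sB n (tShift c)) +
      Polynomial.C (sB (n + 1) (tShift c)) +
      (Polynomial.C (C ε) * Polynomial.X) * Polynomial.C (sB n (tShift c)) := by
  let d : ℕ → Polynomial BRing := fun j =>
    if j % 2 = 1 then Polynomial.C (C (ε * (2 / (j : ℂ)))) * Polynomial.X ^ j else 0
  have h1 := gs_map ψ (tShift c)
  have h2 := gs_map (Polynomial.CAlgHom : BRing →ₐ[ℂ] Polynomial BRing) (tShift c)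
  have h3 : (fun j => ψ (tShift c j)) = fun j => Polynomial.CAlgHom (R := ℂ) (tShift c j) + d j := by
    funext j
    simp only [tShift, tTilde, d, map_add, Polynomial.CAlgHom_apply]
    have hC : ψ (C (c j)) = Polynomial.C (C (c j)) := by
      rw [← MvPolynomial.algebraMap_eq, AlgHom.commutes]; rfl
    rw [hC]
    split_ifs with hj
    · rw [hψ]
      have : 2 * ((j - 1) / 2) + 1 = j := by omega
      rw [this]; ring
    · simp
  have h4 := gs_shift (Polynomial.C (C ε) * Polynomial.X) d (by
    intro j
    simp only [d]
    by_cases hj : j % 2 = 0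
    · rw [if_pos hj, if_pos (by omega)]
      obtain ⟨k, rfl⟩ : ∃ k, j = 2 * k := ⟨j / 2, by omega⟩
      have e1 : ε ^ (2 * k + 1) = ε := by rw [pow_succ, pow_mul, hε]; simp
      rw [mul_pow, ← Polynomial.C_pow, ← MvPolynomial.C_pow, e1]
      have e2 : (((2 * k : ℕ) : Polynomial BRing) + 1) =
          Polynomial.C (C (((2 * k + 1 : ℕ) : ℂ))) := by
        have := map_natCast (Polynomial.C.comp (C : ℂ →+* BRing)) (2 * k + 1)
        rw [← Nat.cast_succ]; exact this.symm
      have e3 : (2 : Polynomial BRing) = Polynomial.C (C 2) := by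
        simp [map_ofNat]
      rw [e2, e3, ← mul_assoc, ← mul_assoc, ← Polynomial.C_mul, ← Polynomial.C_mul,
        ← MvPolynomial.C_mul, ← MvPolynomial.C_mul]
      congr 3
      have : ((2 * k + 1 : ℕ) : ℂ) ≠ 0 := Nat.cast_ne_zero.mpr (by omega)
      field_simp
    · rw [if_neg hj, if_neg (by omega), mul_zero])
  rw [h3, gs_add, ← h2] at h1
  have h5 : PowerSeries.map (ψ : BRing →+* Polynomial BRing) (gs (tShift c)) *
      (1 - PowerSeries.C (Polynomial.C (C ε) * Polynomial.X) * PowerSeries.X) =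
      PowerSeries.map ((Polynomial.CAlgHom : BRing →ₐ[ℂ] Polynomial BRing) : BRing →+* Polynomial BRing)
        (gs (tShift c)) *
      (1 + PowerSeries.C (Polynomial.C (C ε) * Polynomial.X) * PowerSeries.X) := by
    rw [h1, mul_assoc, h4]
  have h6 := congrArg (PowerSeries.coeff (n + 1)) h5
  rw [mul_sub, mul_add, mul_one, mul_one, mul_left_comm, mul_left_comm _ (PowerSeries.C _),
    map_sub, map_add, PowerSeries.coeff_C_mul, PowerSeries.coeff_C_mul,
    PowerSeries.coeff_succ_mul_X, PowerSeries.coeff_succ_mul_X] at h6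
  simp only [PowerSeries.coeff_map, coeff_gs] at h6
  change ψ (sB (n + 1) (tShift c)) - _ * ψ (sB n (tShift c)) =
    Polynomial.C (sB (n + 1) (tShift c)) + _ * Polynomial.C (sB n (tShift c)) at h6
  linear_combination h6

/-- shiftMinus as an algebra hom -/
def shM : BRing →ₐ[ℂ] Polynomial BRing := MvPolynomial.aeval
    (fun i => Polynomial.C (MvPolynomial.X i) -
      Polynomial.C (MvPolynomial.C ((2 : ℂ) / ((2 * i + 1 : ℕ) : ℂ))) *
        Polynomial.X ^ (2 * i + 1))

/-- shiftPlus as an algebra hom -/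
def shP : BRing →ₐ[ℂ] Polynomial BRing := MvPolynomial.aeval
    (fun i => Polynomial.C (MvPolynomial.X i) +
      Polynomial.C (MvPolynomial.C ((2 : ℂ) / ((2 * i + 1 : ℕ) : ℂ))) *
        Polynomial.X ^ (2 * i + 1))

lemma shM_X (i : ℕ) : shM (X i) = Polynomial.C (X i) +
    Polynomial.C (C ((-1) * (2 / ((2 * i + 1 : ℕ) : ℂ)))) * Polynomial.X ^ (2 * i + 1) := by
  simp only [shM, aeval_X, neg_mul, one_mul, map_neg]
  ring

lemma shP_X (i : ℕ) : shP (X i) = Polynomial.C (X i) +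
    Polynomial.C (C (1 * (2 / ((2 * i + 1 : ℕ) : ℂ)))) * Polynomial.X ^ (2 * i + 1) := by
  simp only [shP, aeval_X, one_mul]

lemma sB_zero (c : ℕ → BRing) : sB 0 c = 1 := schur_zero c

lemma psi_C (ψ : BRing →ₐ[ℂ] Polynomial BRing) (b : ℂ) : ψ (C b) = Polynomial.C (C b) := by
  rw [← MvPolynomial.algebraMap_eq, AlgHom.commutes]; rfl

end Shift

section Efacts

/-- constants -/
def Kc (c : ℕ → ℂ) : PowerSeries BRing2 := gs (fun j => C (c j))
/-- left -/
def Lt : PowerSeries BRing2 := gs (fun j => inL (tTilde j))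
/-- left negative -/
def Ltn : PowerSeries BRing2 := gs (fun j => - inL (tTilde j))
/-- right -/
def Rt : PowerSeries BRing2 := gs (fun j => inR (tTilde j))
/-- right negative -/
def Rtn : PowerSeries BRing2 := gs (fun j => - inR (tTilde j))

lemma mapL (c : ℕ → BRing) : PowerSeries.map inL (gs c) = gs (fun j => inL (c j)) :=
  gs_map (MvPolynomial.rename Sum.inl) c
lemma mapR (c : ℕ → BRing) : PowerSeries.map inR (gs c) = gs (fun j => inR (c j)) :=
  gs_map (MvPolynomial.rename Sum.inr) c

lemma inL_C (z : ℂ) : inL (C z) = C z := MvPolynomial.rename_C _ _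
lemma inR_C (z : ℂ) : inR (C z) = C z := MvPolynomial.rename_C _ _

lemma mapL_shift (c : ℕ → ℂ) : PowerSeries.map inL (gs (tShift c)) = Lt * Kc c := by
  rw [mapL, Lt, Kc, ← gs_add]
  simp [tShift, inL_C]
lemma mapR_shift (c : ℕ → ℂ) : PowerSeries.map inR (gs (tShift c)) = Rt * Kc c := by
  rw [mapR, Rt, Kc, ← gs_add]
  simp [tShift, inR_C]

lemma tTilde_neg (j : ℕ) : (-1) ^ j * tTilde j = - tTilde j := by
  unfold tTilde
  split_ifs with h
  · have : Odd j := Nat.odd_iff.mpr h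
    rw [this.neg_one_pow]; ring
  · simp

lemma Lneg : Ltn * Lt = 1 := gs_neg _
lemma Rneg : Rtn * Rt = 1 := gs_neg _

lemma rsL : PowerSeries.rescale (-1 : BRing2) Lt = Ltn := by
  rw [Lt, gs_rescale, Ltn]
  congr 1; funext j
  have := congrArg inL (tTilde_neg j)
  simpa using this
lemma rsR : PowerSeries.rescale (-1 : BRing2) Rt = Rtn := by
  rw [Rt, gs_rescale, Rtn]
  congr 1; funext j
  have := congrArg inR (tTilde_neg j)
  simpa using this
lemma rsRn : PowerSeries.rescale (-1 : BRing2) Rtn = Rt := by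
  rw [Rtn, gs_rescale, Rt]
  congr 1; funext j
  have := congrArg inR (tTilde_neg j)
  simp only [map_mul, map_neg, map_pow, map_one] at this
  rw [mul_neg, this, neg_neg]

lemma Eser_eq : Eser = Lt * Rtn := by
  rw [Eser, mapL, mapR, Lt, Rtn]; simp

lemma Ec_zero : Ec 0 = 1 := by
  have h1 : PowerSeries.coeff 0 Lt = 1 := gs_const _
  have h2 : PowerSeries.coeff 0 Rtn = 1 := gs_const _
  rw [Ec, Eser_eq, PowerSeries.coeff_mul]
  simp [h1, h2, -PowerSeries.coeff_zero_eq_constantCoeff]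

lemma ha_fact (c : ℕ → ℂ) (n : ℕ) : inR (sB n (tShift c)) =
    ∑ p ∈ Finset.HasAntidiagonal.antidiagonal n, (-1) ^ p.1 * Ec p.1 * inL (sB p.2 (tShift c)) := by
  have h : PowerSeries.map inR (gs (tShift c)) = PowerSeries.rescale (-1 : BRing2) Eser *
      PowerSeries.map inL (gs (tShift c)) := by
    rw [mapR_shift, mapL_shift, Eser_eq, map_mul, rsL, rsRn]
    linear_combination (-(Rt * Kc c)) * Lneg
  have := congrArg (PowerSeries.coeff n) h
  rw [PowerSeries.coeff_mul] at this
  simp only [PowerSeries.coeff_map, coeff_gs, PowerSeries.coeff_rescale] at this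
  exact this

lemma hb_fact (c : ℕ → ℂ) (n : ℕ) : inL (sB n (tShift c)) =
    ∑ p ∈ Finset.HasAntidiagonal.antidiagonal n, 1 ^ p.1 * Ec p.1 * inR (sB p.2 (tShift c)) := by
  have h : PowerSeries.map inL (gs (tShift c)) = Eser *
      PowerSeries.map inR (gs (tShift c)) := by
    rw [mapR_shift, mapL_shift, Eser_eq]
    linear_combination (-(Lt * Kc c)) * Rneg
  have := congrArg (PowerSeries.coeff n) h
  rw [PowerSeries.coeff_mul] at this
  simp only [PowerSeries.coeff_map, coeff_gs] at this
  simp only [one_pow, one_mul]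
  exact this

lemma anti_fact (c c' : ℕ → ℂ) (n : ℕ) :
    ∑ p ∈ Finset.HasAntidiagonal.antidiagonal n, (-1) ^ p.1 * inL (sB p.1 (tShift c')) *
      inL (sB p.2 (tShift c)) =
    ∑ p ∈ Finset.HasAntidiagonal.antidiagonal n, (-1) ^ p.1 * inR (sB p.1 (tShift c')) *
      inR (sB p.2 (tShift c)) := by
  have h : PowerSeries.rescale (-1 : BRing2) (PowerSeries.map inL (gs (tShift c'))) *
      PowerSeries.map inL (gs (tShift c)) =
      PowerSeries.rescale (-1 : BRing2) (PowerSeries.map inR (gs (tShift c'))) *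
      PowerSeries.map inR (gs (tShift c)) := by
    simp only [mapR_shift, mapL_shift, map_mul, rsL, rsR]
    linear_combination (PowerSeries.rescale (-1 : BRing2) (Kc c') * Kc c) * Lneg -
      (PowerSeries.rescale (-1 : BRing2) (Kc c') * Kc c) * Rneg
  have := congrArg (PowerSeries.coeff n) h
  rw [PowerSeries.coeff_mul, PowerSeries.coeff_mul] at this
  simp only [PowerSeries.coeff_map, coeff_gs, PowerSeries.coeff_rescale] at this
  exact this

end Efacts

section Final

/-- `1/√2` -/
abbrev qq {ι : Type} : MvPolynomial ι ℂ := C (sqrt2⁻¹)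

lemma qq_sq {ι : Type} : (2 : MvPolynomial ι ℂ) * (qq * qq) = 1 := by
  have h : (2 : ℂ) * (sqrt2⁻¹ * sqrt2⁻¹) = 1 := by
    have h2 : sqrt2 * sqrt2 = 2 := by
      unfold sqrt2
      rw [← Complex.ofReal_mul, Real.mul_self_sqrt (by norm_num)]; simp
    rw [← mul_inv, h2]; norm_num
  have e : (2 : MvPolynomial ι ℂ) = C 2 := by simp [map_ofNat]
  rw [e, ← C_mul, ← C_mul, h, C_1]

lemma rho1B_eq (l : ℕ) (c : ℕ → BRing) (b : ℂ) : rho1B l c b = qq * sB l c + C b := by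
  rw [rho1B, MvPolynomial.smul_eq_C_mul]

lemma rhoB_eq (l μ : ℕ) (c c' : ℕ → BRing) (b b' : ℂ) :
    2 * rhoB l μ c c' b b' = chi2 (fun n => sB n c) (fun n => sB n c') l μ +
      2 * (qq * sB l c * C b' - C b * (qq * sB μ c') - C b * C b') := by
  rw [rhoB, chi2]
  simp only [MvPolynomial.smul_eq_C_mul, map_pow, map_neg, map_one]
  linear_combination (sB l c * sB μ c') * (qq_sq (ι := ℕ))

lemma shift_rhoB (ψ : BRing →ₐ[ℂ] Polynomial BRing) (ε : ℂ) (hε : ε ^ 2 = 1)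
    (hψ : ∀ i, ψ (X i) = Polynomial.C (X i) + Polynomial.C (C (ε * (2 / ((2 * i + 1 : ℕ) : ℂ)))) *
      Polynomial.X ^ (2 * i + 1)) (c c' : ℕ → ℂ) (l μ : ℕ) (b b' : ℂ) :
    ψ (rhoB l μ (tShift c) (tShift c') b b') =
      Polynomial.C (rhoB l μ (tShift c) (tShift c') b b')
      + (- Polynomial.C (rho1B l (tShift c) b)) * ψ (rho1B μ (tShift c') b')
      - (- Polynomial.C (rho1B μ (tShift c') b')) * ψ (rho1B l (tShift c) b) := by
  have h := chi2_shift (Polynomial.C (C ε) * Polynomial.X)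
    (fun n => Polynomial.C (sB n (tShift c))) (fun n => Polynomial.C (sB n (tShift c')))
    (fun n => ψ (sB n (tShift c))) (fun n => ψ (sB n (tShift c')))
    (shift_rec ψ ε hε hψ c) (shift_rec ψ ε hε hψ c')
    (by simp only [sB_zero, map_one]) (by simp only [sB_zero, map_one]) l μ
  have h1 := congrArg ψ (rhoB_eq l μ (tShift c) (tShift c') b b')
  have h2 := congrArg Polynomial.C (rhoB_eq l μ (tShift c) (tShift c') b b')
  have c1 := chi2_map (ψ : BRing →+* Polynomial BRing) (fun n => sB n (tShift c))
    (fun n => sB n (tShift c')) l μ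
  have c2 := chi2_map (Polynomial.C : BRing →+* Polynomial BRing) (fun n => sB n (tShift c))
    (fun n => sB n (tShift c')) l μ
  have c1' : ψ (chi2 (fun n => sB n (tShift c)) (fun n => sB n (tShift c')) l μ) =
    chi2 (fun n => ψ (sB n (tShift c))) (fun n => ψ (sB n (tShift c'))) l μ := c1
  have hq : (2 : Polynomial BRing) * (Polynomial.C qq * Polynomial.C qq) = 1 := by
    have := congrArg (Polynomial.C : BRing →+* Polynomial BRing) (qq_sq (ι := ℕ))
    simpa only [map_mul, map_ofNat, map_one] using this
  simp only [map_mul, map_add, map_sub, map_ofNat, psi_C, c1'] at h1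
  simp only [map_mul, map_add, map_sub, map_ofNat, c2] at h2
  simp only [rho1B_eq, map_mul, map_add, psi_C]
  apply mul_left_cancel₀ (two_ne_zero : (2 : Polynomial BRing) ≠ 0)
  linear_combination h1 - h2 + h + (Polynomial.C (sB l (tShift c)) * ψ (sB μ (tShift c')) -
    Polynomial.C (sB μ (tShift c')) * ψ (sB l (tShift c))) * hq

/-- difference term -/
def Df (l μ : ℕ) (c c' : ℕ → ℂ) (b b' : ℂ) : BRing2 :=
  (chi2 (fun n => inR (sB n (tShift c))) (fun n => inR (sB n (tShift c'))) l μ -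
   chi2 (fun n => inL (sB n (tShift c))) (fun n => inL (sB n (tShift c'))) l μ) +
  2 * ((qq * inR (sB l (tShift c)) * C b' - C b * (qq * inR (sB μ (tShift c')))) -
    (qq * inL (sB l (tShift c)) * C b' - C b * (qq * inL (sB μ (tShift c')))))

lemma Df_rhoB (l μ : ℕ) (c c' : ℕ → ℂ) (b b' : ℂ) : Df l μ c c' b b' =
    2 * (inR (rhoB l μ (tShift c) (tShift c') b b') - inL (rhoB l μ (tShift c) (tShift c') b b')) := by
  have h1 := congrArg inR (rhoB_eq l μ (tShift c) (tShift c') b b')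
  have h2 := congrArg inL (rhoB_eq l μ (tShift c) (tShift c') b b')
  simp only [map_mul, map_add, map_sub, map_ofNat, chi2_map, inR_C, inL_C] at h1 h2
  rw [Df]
  linear_combination h2 - h1

lemma Df_skew (l μ : ℕ) (c c' : ℕ → ℂ) (b b' : ℂ) :
    Df l μ c c' b b' = - Df μ l c' c b' b := by
  have h := chi2_anti (fun n => inL (sB n (tShift c))) (fun n => inL (sB n (tShift c')))
    (fun n => inR (sB n (tShift c))) (fun n => inR (sB n (tShift c'))) (anti_fact c c') l μ
  rw [Df, Df]
  linear_combination -h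

lemma M_eq (l μ : ℕ) (c c' : ℕ → ℂ) (b b' : ℂ) :
    phi Ec ((shM (rho1B l (tShift c) b)).map inL * (shP (rho1B μ (tShift c') b')).map inR) =
      inL (rho1B l (tShift c) b) * inR (rho1B μ (tShift c') b') + Df l μ c c' b b' := by
  have rM : ∀ n, (shM (sB (n + 1) (tShift c))).map inL =
      (Polynomial.C (-1) * Polynomial.X) * (shM (sB n (tShift c))).map inL +
      Polynomial.C (inL (sB (n + 1) (tShift c))) +
      (Polynomial.C (-1) * Polynomial.X) * Polynomial.C (inL (sB n (tShift c))) := by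
    intro n
    rw [shift_rec shM (-1) (by norm_num) shM_X]
    simp [Polynomial.map_add, Polynomial.map_mul]
  have rP : ∀ n, (shP (sB (n + 1) (tShift c'))).map inR =
      (Polynomial.C 1 * Polynomial.X) * (shP (sB n (tShift c'))).map inR +
      Polynomial.C (inR (sB (n + 1) (tShift c'))) +
      (Polynomial.C 1 * Polynomial.X) * Polynomial.C (inR (sB n (tShift c'))) := by
    intro n
    rw [shift_rec shP 1 (by norm_num) shP_X]
    simp [Polynomial.map_add, Polynomial.map_mul]
  have zM : (shM (sB 0 (tShift c))).map inL = 1 := by rw [sB_zero]; simp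
  have zP : (shP (sB 0 (tShift c'))).map inR = 1 := by rw [sB_zero]; simp
  have k1 := phi_sigma Ec Ec_zero (-1) (fun n => inL (sB n (tShift c)))
    (fun n => inR (sB n (tShift c))) (fun n => (shM (sB n (tShift c))).map inL)
    (by simp only [sB_zero, map_one]) zM rM (ha_fact c) l
  have k2 := phi_sigma Ec Ec_zero 1 (fun n => inR (sB n (tShift c')))
    (fun n => inL (sB n (tShift c'))) (fun n => (shP (sB n (tShift c'))).map inR)
    (by simp only [sB_zero, map_one]) zP rP (hb_fact c') μ
  have k3 := main_chi Ec Ec_zero (fun n => inL (sB n (tShift c)))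
    (fun n => inR (sB n (tShift c))) (fun n => inL (sB n (tShift c')))
    (fun n => inR (sB n (tShift c'))) (fun n => (shM (sB n (tShift c))).map inL)
    (fun n => (shP (sB n (tShift c'))).map inR) zM zP
    (by simp only [sB_zero, map_one]) (by simp only [sB_zero, map_one])
    (by simp only [sB_zero, map_one]) (by simp only [sB_zero, map_one]) rM rP
    (ha_fact c) (hb_fact c') l μ
  have e1 : (shM (rho1B l (tShift c) b)).map inL * (shP (rho1B μ (tShift c') b')).map inR =
      Polynomial.C (qq * qq) * ((shM (sB l (tShift c))).map inL * (shP (sB μ (tShift c'))).map inR) +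
      Polynomial.C (qq * C b') * (shM (sB l (tShift c))).map inL +
      Polynomial.C (C b * qq) * (shP (sB μ (tShift c'))).map inR + Polynomial.C (C b * C b') := by
    simp only [rho1B_eq, map_add, map_mul, psi_C, Polynomial.map_add, Polynomial.map_mul,
      Polynomial.map_C, inL_C, inR_C]
    ring
  rw [e1, map_add, map_add, map_add, phi_C_mul, phi_C_mul, phi_C_mul, phi_C, Ec_zero]
  rw [k1, k2, k3, Df]
  simp only [rho1B_eq, map_add, map_mul, inL_C, inR_C]
  linear_combination (chi2 (fun n => inR (sB n (tShift c))) (fun n => inR (sB n (tShift c'))) l μ -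
   chi2 (fun n => inL (sB n (tShift c))) (fun n => inL (sB n (tShift c'))) l μ) *
    (qq_sq (ι := ℕ ⊕ ℕ))

variable {m : ℕ}

lemma skewOf_skew {R : Type*} [CommRing R] (f : Fin m → Fin m → R) (i j : Fin m) :
    skewOf f i j = - skewOf f j i := by
  simp only [skewOf, Matrix.of_apply]
  rcases lt_trichotomy i j with h | h | h
  · rw [if_pos h, if_neg h.asymm, if_pos h, neg_neg]
  · subst h; simp
  · rw [if_neg h.asymm, if_pos h, if_pos h]

lemma even_shift (ψ : BRing →ₐ[ℂ] Polynomial BRing) (ε : ℂ) (hε : ε ^ 2 = 1)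
    (hψ : ∀ i, ψ (X i) = Polynomial.C (X i) + Polynomial.C (C (ε * (2 / ((2 * i + 1 : ℕ) : ℂ)))) *
      Polynomial.X ^ (2 * i + 1)) (lam : Fin m → ℕ) (c : Fin m → ℕ → ℂ) (b : Fin m → ℂ)
      (i j : Fin m) :
    ψ (rhoMatrixEven lam c b i j) = Polynomial.C (rhoMatrixEven lam c b i j)
      + (- Polynomial.C (rho1B (lam i) (tShift (c i)) (b i))) * ψ (rho1B (lam j) (tShift (c j)) (b j))
      - (- Polynomial.C (rho1B (lam j) (tShift (c j)) (b j))) *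
        ψ (rho1B (lam i) (tShift (c i)) (b i)) := by
  simp only [rhoMatrixEven, skewOf, Matrix.of_apply]
  rcases lt_trichotomy i j with h | h | h
  · rw [if_pos h]
    exact shift_rhoB ψ ε hε hψ _ _ _ _ _ _
  · subst h; simp
  · rw [if_neg h.asymm, if_pos h, map_neg, map_neg, shift_rhoB ψ ε hε hψ]
    ring

lemma Df_even (lam : Fin m → ℕ) (c : Fin m → ℕ → ℂ) (b : Fin m → ℂ) (i j : Fin m) :
    Df (lam i) (lam j) (c i) (c j) (b i) (b j) =
    2 * (inR (rhoMatrixEven lam c b i j) - inL (rhoMatrixEven lam c b i j)) := by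
  simp only [rhoMatrixEven, skewOf, Matrix.of_apply]
  rcases lt_trichotomy i j with h | h | h
  · rw [if_pos h]
    exact Df_rhoB _ _ _ _ _ _
  · subst h
    have := self_eq_neg.mp (Df_skew (lam i) (lam i) (c i) (c i) (b i) (b i))
    simp [this]
  · rw [if_neg h.asymm, if_pos h, Df_skew, Df_rhoB, map_neg, map_neg]
    ring

lemma odd_eq_bord (lam : Fin m → ℕ) (c : Fin m → ℕ → ℂ) (b : Fin m → ℂ) :
    rhoMatrixOdd lam c b =
      bord (fun j => rho1B (lam j) (tShift (c j)) (b j)) (rhoMatrixEven lam c b) := by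
  ext1 i j
  refine Fin.cases ?_ (fun i => ?_) i <;> refine Fin.cases ?_ (fun j => ?_) j
  · simp [rhoMatrixOdd, skewOf]
  · simp [rhoMatrixOdd, skewOf]
  · simp [rhoMatrixOdd, skewOf]
  · simp [rhoMatrixOdd, rhoMatrixEven, skewOf]

lemma shift_pf {K : Type*} [Fintype K] [DecidableEq K] (e : K × Bool ≃ Fin (m + 1))
    (ψ : BRing →ₐ[ℂ] Polynomial BRing) (ε : ℂ) (hε : ε ^ 2 = 1)
    (hψ : ∀ i, ψ (X i) = Polynomial.C (X i) + Polynomial.C (C (ε * (2 / ((2 * i + 1 : ℕ) : ℂ)))) *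
      Polynomial.X ^ (2 * i + 1)) (lam : Fin m → ℕ) (c : Fin m → ℕ → ℂ) (b : Fin m → ℂ) :
    ψ (pfF e (rhoMatrixOdd lam c b)) = ∑ j, ψ (rho1B (lam j) (tShift (c j)) (b j)) *
      Polynomial.C (cof e (rhoMatrixEven lam c b) j) := by
  have h1 := pfF_map (ψ : BRing →+* Polynomial BRing) e (rhoMatrixOdd lam c b)
  rw [odd_eq_bord, bord_map, pfF_bord_add e _
    (fun i => - Polynomial.C (rho1B (lam i) (tShift (c i)) (b i)))
    ((rhoMatrixEven lam c b).map (Polynomial.C : BRing →+* Polynomial BRing))] at h1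
  · rw [odd_eq_bord]
    refine Eq.trans h1 ?_
    rw [pfF_bord]
    refine Finset.sum_congr rfl fun j _ => ?_
    rw [← cof_map]
    rfl
  · exact even_shift ψ ε hε hψ lam c b

lemma final {K : Type*} [Fintype K] [DecidableEq K] (e : K × Bool ≃ Fin (m + 1))
    (lam : Fin m → ℕ) (c : Fin m → ℕ → ℂ) (b : Fin m → ℂ) :
    phi Ec ((shM (pfF e (rhoMatrixOdd lam c b))).map inL *
      (shP (pfF e (rhoMatrixOdd lam c b))).map inR) =
    inL (pfF e (rhoMatrixOdd lam c b)) * inR (pfF e (rhoMatrixOdd lam c b)) := by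
  set A := rhoMatrixEven lam c b with hA
  set k := cof e A with hk
  set r : Fin m → BRing := fun j => rho1B (lam j) (tShift (c j)) (b j) with hr
  have hF : pfF e (rhoMatrixOdd lam c b) = ∑ j, r j * k j := by
    rw [odd_eq_bord, pfF_bord]
  have horth : ∀ i, ∑ j, A i j * k j = 0 := cof_orth e A (skewOf_skew _)
  have horth' : ∀ j, ∑ i, A i j * k i = 0 := by
    intro j
    rw [← neg_eq_zero, ← Finset.sum_neg_distrib, ← horth j]
    refine Finset.sum_congr rfl fun i _ => ?_
    have : A i j = - A j i := skewOf_skew _ i j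
    rw [this]; ring
  rw [shift_pf e shM (-1) (by norm_num) shM_X, shift_pf e shP 1 (by norm_num) shP_X,
    Polynomial.map_sum, Polynomial.map_sum, Finset.sum_mul_sum, map_sum]
  have hterm : ∀ i j, phi Ec (((shM (r i) * Polynomial.C (k i)).map inL) *
      ((shP (r j) * Polynomial.C (k j)).map inR)) =
      (inL (r i * k i) * inR (r j * k j) + 2 * (inL (k i) * inR (A i j * k j))) -
        2 * (inR (k j) * inL (A i j * k i)) := by
    intro i j
    have : ((shM (r i) * Polynomial.C (k i)).map inL) * ((shP (r j) * Polynomial.C (k j)).map inR) =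
        Polynomial.C (inL (k i) * inR (k j)) * ((shM (r i)).map inL * (shP (r j)).map inR) := by
      simp only [Polynomial.map_mul, Polynomial.map_C, map_mul]; ring
    rw [this, phi_C_mul, hr, M_eq, Df_even, ← hA]
    simp only [map_mul]
    ring
  have hsum : ∀ i, phi Ec (∑ j, ((shM (r i) * Polynomial.C (k i)).map inL) *
      ((shP (r j) * Polynomial.C (k j)).map inR)) =
      ∑ j, ((inL (r i * k i) * inR (r j * k j) + 2 * (inL (k i) * inR (A i j * k j))) -
        2 * (inR (k j) * inL (A i j * k i))) := by
    intro i
    rw [map_sum]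
    exact Finset.sum_congr rfl fun j _ => hterm i j
  refine (Finset.sum_congr rfl fun i _ => hsum i).trans ?_
  simp only [Finset.sum_sub_distrib, Finset.sum_add_distrib]
  have z1 : ∑ i, ∑ j, 2 * (inL (k i) * inR (A i j * k j)) = 0 := by
    refine Finset.sum_eq_zero fun i _ => ?_
    rw [← Finset.mul_sum, ← Finset.mul_sum, ← map_sum, horth]; simp
  have z2 : ∑ i, ∑ j, 2 * (inR (k j) * inL (A i j * k i)) = 0 := by
    rw [Finset.sum_comm]
    refine Finset.sum_eq_zero fun j _ => ?_
    rw [← Finset.mul_sum, ← Finset.mul_sum, ← map_sum, horth']; simp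
  rw [z1, z2, hF, map_sum, map_sum, Finset.sum_mul_sum]
  ring

lemma main_thm (hm : (m + 1) % 2 = 0) (lam : Fin m → ℕ) (c : Fin m → ℕ → ℂ) (b : Fin m → ℂ) :
    SatisfiesBKP (pfaffian (rhoMatrixOdd lam c b)) := by
  obtain ⟨N, hN, hpf⟩ := pfaffian_norm hm
  have h := final (pairE (m + 1) hm) lam c b
  rw [hpf (rhoMatrixOdd lam c b) (skewOf_skew _)] at h
  rw [bkp_iff]
  change phi Ec ((shM _).map inL * (shP _).map inR) = _
  set τ := pfaffian (rhoMatrixOdd lam c b)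
  have e : ((shM ((N : BRing) * τ)).map inL * (shP ((N : BRing) * τ)).map inR) =
      Polynomial.C ((N : BRing2) * N) * ((shM τ).map inL * (shP τ).map inR) := by
    simp only [map_mul, map_natCast, Polynomial.map_mul, Polynomial.map_natCast]
    ring
  rw [e, phi_C_mul] at h
  simp only [map_mul, map_natCast] at h
  have hN' : ((N : BRing2) * N) ≠ 0 := mul_ne_zero (Nat.cast_ne_zero.mpr hN) (Nat.cast_ne_zero.mpr hN)
  apply mul_left_cancel₀ hN'
  rw [h]; ring

end Final

end BKPProof
end

noncomputable section

/-- For every `n ≥ 0`, integers `λ_1 > ⋯ > λ_{2n+1} ≥ 0`, sequences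
`c_1, …, c_{2n+1}` of complex numbers and `b_1, …, b_{2n+1} ∈ ℂ`, the Pfaffian `τ₁ = Pf(A)`
of the `(2n+2) × (2n+2)` skew-symmetric matrix `A` with `A_{0,j} = ρ_{λ_j}(t̃+c_j; b_j)`
and `A_{i,j} = ρ_{λ_i,λ_j}(t̃+c_i, t̃+c_j; b_i, b_j)` for `1 ≤ i < j ≤ 2n+1` satisfies the
BKP bilinear identity (the bosonic form of the DKP hierarchy on the odd sector `V₁`). -/
theorem polynomial_tau_DKP_odd (n : ℕ) (lam : Fin (2 * n + 1) → ℕ) (hlam : StrictAnti lam)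
    (c : Fin (2 * n + 1) → ℕ → ℂ) (b : Fin (2 * n + 1) → ℂ) :
    SatisfiesBKP (pfaffian (rhoMatrixOdd lam c b)) := by
  exact BKPProof.main_thm (by omega) lam c b

end
end
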